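/- arXiv:2112.04395 — 4 statements merged into one kernel-verified Lean document; each statement's English description precedes it below -/
import Mathlib

section
/- Let X = (X_1,...,X_n) be an integer-valued random vector with characteristic function φ, and let m be a positive integer. Then the probability that m divides X_k for every k = 1,...,n equals m^{-n} · Σ_{j_1=0}^{m-1} ... Σ_{j_n=0}^{m-1} φ(2π j_1/m, ..., 2π j_n/m). -/
open MeasureTheory

/-- Orthogonality of the additive characters of `ℤ/mℤ`, summed over the dual group. -/
theorem sum_exp_two_pi_mul_div_eq_ite {m : ℕ} (hm : 0 < m) (x : ℤ) :
    ∑ j : Fin m, Complex.exp (Complex.I * ((2 * Real.pi * (j : ℕ) / m * (x : ℝ) : ℝ) : ℂ)) =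
      if (m : ℤ) ∣ x then (m : ℂ) else 0 := by
  have hprim := Complex.isPrimitiveRoot_exp m hm.ne'
  set ζ : ℂ := Complex.exp (2 * Real.pi * Complex.I / m) with hζ
  have hterm (j : ℕ) :
      Complex.exp (Complex.I * ((2 * Real.pi * j / m * (x : ℝ) : ℝ) : ℂ)) = (ζ ^ x) ^ j := by
    rw [hζ, ← Complex.exp_int_mul, ← Complex.exp_nat_mul]
    congr 1
    push_cast
    ring
  simp only [hterm]
  rw [Fin.sum_univ_eq_sum_range (fun j => (ζ ^ x) ^ j)]
  split_ifs with h
  · simp [(hprim.zpow_eq_one_iff_dvd x).2 h]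
  · have hne : ζ ^ x ≠ 1 := fun h' => h ((hprim.zpow_eq_one_iff_dvd x).1 h')
    rw [geom_sum_eq hne, ← zpow_natCast, zpow_comm, zpow_natCast, hprim.pow_eq_one]
    simp

/-- The multidimensional form of `sum_exp_two_pi_mul_div_eq_ite`. -/
theorem sum_exp_sum_two_pi_mul_div_eq_ite {ι : Type*} [Fintype ι] [DecidableEq ι] {m : ℕ}
    (hm : 0 < m) (x : ι → ℤ) :
    ∑ j : ι → Fin m,
        Complex.exp (Complex.I * ((∑ k, 2 * Real.pi * (j k : ℕ) / m * (x k : ℝ) : ℝ) : ℂ)) =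
      if ∀ k, (m : ℤ) ∣ x k then (m : ℂ) ^ Fintype.card ι else 0 := by
  simp only [Complex.ofReal_sum, Finset.mul_sum, Complex.exp_sum]
  rw [← Fintype.prod_sum fun (k : ι) (j : Fin m) =>
    Complex.exp (Complex.I * ((2 * Real.pi * (j : ℕ) / m * (x k : ℝ) : ℝ) : ℂ))]
  simp only [sum_exp_two_pi_mul_div_eq_ite hm, Finset.prod_ite_zero, Finset.mem_univ,
    true_imp_iff, Finset.prod_const, Finset.card_univ]

/-- For an integer-valued random vector `X` with characteristic function `φ`, the probability
that `m` divides every coordinate equals `m^{-n} Σ_{j ∈ {0,…,m-1}^n} φ(2πj₁/m, …, 2πjₙ/m)`. -/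
theorem prob_dvd_eq_sum_charFun
    {Ω : Type*} [MeasurableSpace Ω] (μ : Measure Ω) [IsProbabilityMeasure μ]
    (n m : ℕ) (hm : 0 < m) (X : Fin n → Ω → ℤ) (hX : ∀ k, Measurable (X k))
    (φ : (Fin n → ℝ) → ℂ)
    (hφ : ∀ t : Fin n → ℝ,
      φ t = ∫ ω, Complex.exp (Complex.I * ((∑ k, t k * (X k ω : ℝ) : ℝ) : ℂ)) ∂μ) :
    ((μ {ω | ∀ k, (m : ℤ) ∣ X k ω}).toReal : ℂ) =
      (1 / (m : ℂ) ^ n) *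
        ∑ j : Fin n → Fin m, φ (fun k => 2 * Real.pi * (j k : ℕ) / m) := by
  have hint (j : Fin n → Fin m) : Integrable (fun ω => Complex.exp
      (Complex.I * ((∑ k, 2 * Real.pi * (j k : ℕ) / m * (X k ω : ℝ) : ℝ) : ℂ))) μ := by
    refine Integrable.of_bound (C := 1) ?_ (ae_of_all _ fun ω => ?_)
    · exact Measurable.aestronglyMeasurable (by fun_prop)
    · rw [mul_comm, Complex.norm_exp_ofReal_mul_I]
  have hmeas : MeasurableSet {ω | ∀ k, (m : ℤ) ∣ X k ω} := by
    rw [Set.ofPred_forall]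
    exact MeasurableSet.iInter fun k => hX k (MeasurableSet.of_discrete (s := {x | (m : ℤ) ∣ x}))
  have hm0 : (m : ℂ) ≠ 0 := Nat.cast_ne_zero.2 hm.ne'
  simp only [hφ]
  rw [← integral_finsetSum _ fun j _ => hint j]
  simp only [sum_exp_sum_two_pi_mul_div_eq_ite hm]
  convert_to _ = 1 / (m : ℂ) ^ n *
    ∫ ω, {ω | ∀ k, (m : ℤ) ∣ X k ω}.indicator (fun _ => (m : ℂ) ^ n) ω ∂μ
  · congr 2
    ext ω
    simp [Set.indicator_apply]
  rw [integral_indicator_const _ hmeas, Complex.real_smul, measureReal_def]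
  field_simp
end

section
/- Fix an odd integer k > 11 not divisible by 11 and a real ε ∈ (0,1). For every δ > 0 there is N such that for all n ≥ N the following holds: if U_0, U_1, ..., U_{10} are pairwise disjoint subsets of [n] with n(1−ε)/(11k) < |U_i| < n(1+ε)/(11k) for each i, and U = U_0 ∪ ... ∪ U_{10}, then for every set A of graphs on the vertex set U, |P[G_n|_U ∈ A and U(G_n) = U] − P[G_U ∈ A] · P[U(G_n) = U]| ≤ δ · P[G_U ∈ A] · P[U(G_n) = U]. -/
/-- The degree of a vertex in a (possibly non-decidable) simple graph. -/
noncomputable def ndeg {V : Type*} (G : SimpleGraph V) (v : V) : ℕ :=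
  Nat.card (G.neighborSet v)

/-- The probability that a uniformly random graph on the (finite) vertex type `V`
belongs to the set `A`. -/
noncomputable def gprob {V : Type*} (A : Set (SimpleGraph V)) : ℝ :=
  (Nat.card A : ℝ) / 2 ^ (Nat.card V).choose 2

/-- `U(G)`: the set of vertices of `G` whose degree is divisible by `k`. -/
def divisorSet {n : ℕ} (k : ℕ) (G : SimpleGraph (Fin n)) : Set (Fin n) :=
  {v | k ∣ ndeg G v}

open Finset

theorem norm_one_add_le_two_mul_of_ne_zero (k : ℕ) [NeZero k] (hk : 1 < k) :
    ∃ c : ℝ, 0 < c ∧ c < 1 ∧ ∀ t : ZMod k, t ≠ 0 → ‖1 + ZMod.stdAddChar t‖ ≤ 2 * c := by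
  have hlt : ∀ t : ZMod k, t ≠ 0 → ‖1 + ZMod.stdAddChar t‖ < 2 := by
    intro t ht
    have h1 : ZMod.stdAddChar t ≠ 1 := by
      intro h
      exact ht (ZMod.injective_stdAddChar (by rw [h, AddChar.map_zero_eq_one]))
    have h2 : ‖ZMod.stdAddChar t‖ = 1 := AddChar.norm_apply _ _
    have h3 : ‖(1 : ℂ) + ZMod.stdAddChar t‖ < ‖(1 : ℂ)‖ + ‖ZMod.stdAddChar t‖ := by
      apply norm_add_lt_of_not_sameRay
      intro h
      exact h1 ((sameRay_iff_of_norm_eq (by simp [h2])).1 h).symm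
    rw [h2, norm_one] at h3
    linarith
  have : Fact (1 < k) := ⟨hk⟩
  obtain ⟨t₀, ht₀, hmax⟩ := Finset.exists_max_image (univ.filter fun t : ZMod k => t ≠ 0)
    (fun t => ‖1 + ZMod.stdAddChar t‖) ⟨1, by simp⟩
  refine ⟨max (1 / 2) (‖1 + ZMod.stdAddChar t₀‖ / 2), by positivity, ?_, ?_⟩
  · have := hlt t₀ (by simpa using ht₀)
    exact max_lt (by norm_num) (by linarith)
  · intro t ht
    have := hmax t (by simpa using ht)
    have h2 := le_max_right (1 / 2 : ℝ) (‖1 + ZMod.stdAddChar t₀‖ / 2)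
    linarith

theorem sum_stdAddChar_mul (k : ℕ) [NeZero k] (a : ZMod k) :
    ∑ t : ZMod k, ZMod.stdAddChar (t * a) = if a = 0 then (k : ℂ) else 0 := by
  rw [AddChar.sum_mulShift a (ZMod.isPrimitive_stdAddChar k)]
  simp

/-- The degrees modulo `k` of the graph with edge set `T`. -/
def edgeDegrees {V : Type*} [DecidableEq V] (k : ℕ) (T : Finset (Sym2 V)) (v : V) : ZMod k :=
  ∑ e ∈ T, if v ∈ e then 1 else 0

/-- The sum of `θ` over the endpoints of `e`. -/
def endpointSum {V : Type*} [Fintype V] [DecidableEq V] {k : ℕ} (θ : V → ZMod k)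
    (e : Sym2 V) : ZMod k :=
  ∑ v, if v ∈ e then θ v else 0

theorem endpointSum_mk {V : Type*} [Fintype V] [DecidableEq V] {k : ℕ} (θ : V → ZMod k)
    {i j : V} (h : i ≠ j) : endpointSum θ s(i, j) = θ i + θ j := by
  have : ∀ v, (if v ∈ s(i, j) then θ v else 0) =
      (if v = i then θ i else 0) + (if v = j then θ j else 0) := by
    intro v
    by_cases h1 : v = i <;> by_cases h2 : v = j <;> simp_all
  simp [endpointSum, this, Finset.sum_add_distrib, -Sym2.mem_iff]

theorem sum_mul_edgeDegrees {V : Type*} [Fintype V] [DecidableEq V] {k : ℕ} (θ : V → ZMod k)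
    (T : Finset (Sym2 V)) :
    ∑ v, θ v * edgeDegrees k T v = ∑ e ∈ T, endpointSum θ e := by
  simp only [edgeDegrees, endpointSum, Finset.mul_sum]
  rw [Finset.sum_comm]
  simp

theorem stdAddChar_sum {k : ℕ} [NeZero k] {ι : Type*} (s : Finset ι) (f : ι → ZMod k) :
    ZMod.stdAddChar (∑ i ∈ s, f i) = ∏ i ∈ s, ZMod.stdAddChar (f i) := by
  classical
  induction s using Finset.induction_on with
  | empty => simp
  | insert a s ha ih => rw [sum_insert ha, prod_insert ha, AddChar.map_add_eq_mul, ih]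

theorem sum_stdAddChar_dot {V : Type*} [Fintype V] [DecidableEq V] (k : ℕ) [NeZero k]
    (a : V → ZMod k) :
    ∑ θ : V → ZMod k, ZMod.stdAddChar (∑ v, θ v * a v) =
      if a = 0 then (k : ℂ) ^ Fintype.card V else 0 := by
  have h : ∏ v, ∑ t : ZMod k, ZMod.stdAddChar (t * a v) =
      ∑ θ : V → ZMod k, ZMod.stdAddChar (∑ v, θ v * a v) := by
    rw [Finset.prod_univ_sum, Fintype.piFinset_univ]
    simp only [stdAddChar_sum]
  rw [← h]
  simp only [sum_stdAddChar_mul]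
  split_ifs with ha
  · simp [ha]
  · obtain ⟨v, hv⟩ := Function.ne_iff.1 ha
    exact Finset.prod_eq_zero (mem_univ v) (if_neg hv)

theorem card_filter_edgeDegrees_eq {V : Type*} [Fintype V] [DecidableEq V] (k : ℕ) [NeZero k]
    (E : Finset (Sym2 V)) (x : V → ZMod k) :
    (k : ℂ) ^ Fintype.card V * #{T ∈ E.powerset | edgeDegrees k T = x} =
      ∑ θ : V → ZMod k, ZMod.stdAddChar (-∑ v, θ v * x v) *
        ∏ e ∈ E, (1 + ZMod.stdAddChar (endpointSum θ e)) := by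
  have h1 : ∀ T : Finset (Sym2 V),
      ∑ θ : V → ZMod k, ZMod.stdAddChar (∑ v, θ v * (edgeDegrees k T v - x v)) =
        if edgeDegrees k T = x then (k : ℂ) ^ Fintype.card V else 0 := by
    intro T
    have := sum_stdAddChar_dot k (edgeDegrees k T - x)
    simpa [sub_eq_zero] using this
  calc (k : ℂ) ^ Fintype.card V * #{T ∈ E.powerset | edgeDegrees k T = x}
      = ∑ T ∈ E.powerset, if edgeDegrees k T = x then (k : ℂ) ^ Fintype.card V else 0 := by
        rw [← Finset.sum_filter, Finset.sum_const, nsmul_eq_mul, mul_comm]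
    _ = _ := by
        simp only [← h1]
        rw [Finset.sum_comm]
        refine Finset.sum_congr rfl fun θ _ => ?_
        rw [Finset.prod_one_add, Finset.mul_sum]
        refine Finset.sum_congr rfl fun T _ => ?_
        rw [← stdAddChar_sum, ← AddChar.map_add_eq_mul, ← sum_mul_edgeDegrees]
        congr 1
        simp only [mul_sub, Finset.sum_sub_distrib]
        ring

theorem norm_prod_one_add_le {V : Type*} [Fintype V] [DecidableEq V] {k : ℕ} [NeZero k]
    {c : ℝ} (hc : 0 < c) (hc1 : c < 1)
    (hck : ∀ t : ZMod k, t ≠ 0 → ‖1 + ZMod.stdAddChar t‖ ≤ 2 * c)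
    (E : Finset (Sym2 V)) (θ : V → ZMod k) (m : ℕ)
    (hm : m ≤ #{e ∈ E | endpointSum θ e ≠ 0}) :
    ‖∏ e ∈ E, (1 + ZMod.stdAddChar (endpointSum θ e))‖ ≤ 2 ^ #E * c ^ m := by
  rw [norm_prod]
  calc ∏ e ∈ E, ‖1 + ZMod.stdAddChar (endpointSum θ e)‖
      ≤ ∏ e ∈ E, (2 * if endpointSum θ e ≠ 0 then c else 1) := by
        refine Finset.prod_le_prod (fun _ _ => norm_nonneg _) fun e _ => ?_
        split_ifs with h
        · exact hck _ h
        · refine (norm_add_le _ _).trans ?_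
          rw [AddChar.norm_apply, norm_one]
          norm_num
    _ = 2 ^ #E * c ^ #{e ∈ E | endpointSum θ e ≠ 0} := by
        rw [Finset.prod_mul_distrib, Finset.prod_const, ← Finset.prod_filter, Finset.prod_const]
    _ ≤ 2 ^ #E * c ^ m := by
        gcongr 2 ^ #E * ?_
        exact pow_le_pow_of_le_one hc.le hc1.le hm

theorem sum_pow_support {V : Type*} [Fintype V] [DecidableEq V] (k : ℕ) [NeZero k] (q : ℝ) :
    ∑ θ : V → ZMod k, q ^ #{v | θ v ≠ 0} = (1 + ((k : ℝ) - 1) * q) ^ Fintype.card V := by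
  have h : ∏ _v : V, ∑ t : ZMod k, (if t ≠ 0 then q else 1) =
      ∑ θ : V → ZMod k, ∏ v, if θ v ≠ 0 then q else 1 := by
    rw [Finset.prod_univ_sum, Fintype.piFinset_univ]
  have h2 : ∑ t : ZMod k, (if t ≠ 0 then q else 1) = 1 + ((k : ℝ) - 1) * q := by
    rw [← Finset.add_sum_erase _ _ (mem_univ (0 : ZMod k))]
    rw [Finset.sum_congr rfl (g := fun _ => q) (fun t ht => by simp [(Finset.mem_erase.1 ht).1])]
    have : 1 ≤ k := Nat.one_le_iff_ne_zero.2 (NeZero.ne k)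
    simp [Finset.card_erase_of_mem, ZMod.card, Nat.cast_sub this]
  rw [h2, Finset.prod_const, Finset.card_univ] at h
  rw [h]
  refine Finset.sum_congr rfl fun θ _ => ?_
  rw [← Finset.prod_filter, Finset.prod_const]

theorem abs_card_filter_edgeDegrees_sub_le {V : Type*} [Fintype V] [DecidableEq V]
    {k : ℕ} [NeZero k] {c : ℝ} (hc : 0 < c) (hc1 : c < 1)
    (hck : ∀ t : ZMod k, t ≠ 0 → ‖1 + ZMod.stdAddChar t‖ ≤ 2 * c)
    (E : Finset (Sym2 V)) (r : ℕ)
    (hE : ∀ θ : V → ZMod k, #{v | θ v ≠ 0} * r ≤ #{e ∈ E | endpointSum θ e ≠ 0})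
    (x : V → ZMod k) :
    |(k : ℝ) ^ Fintype.card V * #{T ∈ E.powerset | edgeDegrees k T = x} - 2 ^ #E| ≤
      2 ^ #E * ((1 + ((k : ℝ) - 1) * c ^ r) ^ Fintype.card V - 1) := by
  have h0 := card_filter_edgeDegrees_eq k E x
  rw [← Finset.add_sum_erase _ _ (mem_univ (0 : V → ZMod k))] at h0
  have h00 : ZMod.stdAddChar (-∑ v, (0 : V → ZMod k) v * x v) *
        ∏ e ∈ E, (1 + ZMod.stdAddChar (endpointSum (0 : V → ZMod k) e)) = (2 : ℂ) ^ #E := by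
    simp [endpointSum]
    norm_num
  rw [h00] at h0
  have h1 : |(k : ℝ) ^ Fintype.card V * #{T ∈ E.powerset | edgeDegrees k T = x} - 2 ^ #E| =
      ‖(k : ℂ) ^ Fintype.card V * #{T ∈ E.powerset | edgeDegrees k T = x} - 2 ^ #E‖ := by
    rw [← Real.norm_eq_abs, ← Complex.norm_real]
    push_cast
    rfl
  rw [h1, h0, add_sub_cancel_left]
  calc _ ≤ ∑ θ ∈ univ.erase (0 : V → ZMod k), 2 ^ #E * (c ^ r) ^ #{v | θ v ≠ 0} := by
        refine (norm_sum_le _ _).trans (Finset.sum_le_sum fun θ _ => ?_)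
        rw [norm_mul, AddChar.norm_apply, one_mul, ← pow_mul, mul_comm r]
        exact norm_prod_one_add_le hc hc1 hck E θ _ (hE θ)
    _ = _ := by
        rw [← Finset.mul_sum, ← sum_pow_support k (c ^ r),
          ← Finset.add_sum_erase _ _ (mem_univ (0 : V → ZMod k))]
        simp

theorem card_nonzero_mul_le_card_endpointSum_ne_zero {n k : ℕ} (hk : Odd k) (hn : 64 ≤ n)
    (W : Finset (Fin n)) (hW : n ≤ 2 * #W) (E : Finset (Sym2 (Fin n)))
    (hE : ∀ i j, i ≠ j → i ∈ W → s(i, j) ∈ E) (θ : Fin n → ZMod k) :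
    #{v | θ v ≠ 0} * (n / 64) ≤ #{e ∈ E | endpointSum θ e ≠ 0} := by
  have key : ∀ P : Finset (Fin n × Fin n),
      (∀ p ∈ P, p.1 ≠ p.2 ∧ p.2 ∈ W ∧ θ p.1 + θ p.2 ≠ 0) →
      #P ≤ 2 * #{e ∈ E | endpointSum θ e ≠ 0} := by
    intro P hP
    have h1 : #P ≤ 2 * #(P.image fun p => s(p.1, p.2)) := by
      refine Finset.card_le_mul_card_image P 2 fun b _ => ?_
      induction b using Sym2.ind with
      | _ i j =>
        refine (Finset.card_le_card (t := {(i, j), (j, i)}) ?_).trans Finset.card_le_two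
        rintro ⟨a, b⟩ h
        simp only [Finset.mem_filter, Sym2.eq_iff] at h
        simp only [Finset.mem_insert, Finset.mem_singleton, Prod.mk.injEq]
        exact h.2
    refine h1.trans (Nat.mul_le_mul_left 2 (Finset.card_le_card ?_))
    intro e he
    obtain ⟨⟨i, j⟩, hp, rfl⟩ := Finset.mem_image.1 he
    obtain ⟨hij, hj, hs⟩ := hP _ hp
    refine Finset.mem_filter.2 ⟨?_, ?_⟩
    · rw [Sym2.eq_swap]
      exact hE j i hij.symm hj
    · rwa [endpointSum_mk θ hij]
  have hs : #{v | θ v ≠ 0} ≤ n := (Finset.card_le_univ _).trans (by simp)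
  by_cases hmaj : ∃ a : ZMod k, a ≠ 0 ∧ #W ≤ 2 * #{j ∈ W | θ j = a}
  · obtain ⟨a, ha, hWa⟩ := hmaj
    have h2a : a + a ≠ 0 := by
      intro h
      have h2 : IsUnit ((2 : ℕ) : ZMod k) := by
        rw [ZMod.isUnit_iff_coprime]
        exact (Nat.coprime_two_left).2 hk
      apply ha
      have h3 : ((2 : ℕ) : ZMod k) * a = 0 := by
        push_cast; rw [two_mul, h]
      exact (h2.mul_right_eq_zero).1 h3
    have hP := key ({j ∈ W | θ j = a}).offDiag (by
      rintro ⟨i, j⟩ h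
      simp only [Finset.mem_offDiag, Finset.mem_filter] at h
      refine ⟨h.2.2, h.2.1.1, ?_⟩
      simp only [h.1.2, h.2.1.2]
      exact h2a)
    rw [Finset.offDiag_card] at hP
    set m := #{j ∈ W | θ j = a}
    set b := #{e ∈ E | endpointSum θ e ≠ 0}
    have hmn : n ≤ 4 * m := by omega
    have hd : 64 * (n / 64) ≤ n := Nat.mul_div_le n 64
    have h1 : #{v | θ v ≠ 0} * (n / 64) ≤ (4 * m) * (n / 64) :=
      Nat.mul_le_mul_right _ (hs.trans hmn)
    have h2 : 16 * (n / 64) ≤ m := by omega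
    have h3 : m * (16 * (n / 64)) ≤ m * m := Nat.mul_le_mul_left m h2
    have h4 : 2 * m ≤ m * m := Nat.mul_le_mul_right m (by omega)
    have h5 : 2 * (m * m - m) ≥ m * m := by omega
    nlinarith
  · push Not at hmaj
    have hP := key (((univ.filter fun v => θ v ≠ 0) ×ˢ W).filter
        fun p => p.1 ≠ p.2 ∧ θ p.1 + θ p.2 ≠ 0) (by
      rintro ⟨i, j⟩ h
      simp only [Finset.mem_filter, Finset.mem_product] at h
      exact ⟨h.2.1, h.1.2, h.2.2⟩)
    have hcount : #{v | θ v ≠ 0} * (2 * (n / 64)) ≤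
        #(((univ.filter fun v => θ v ≠ 0) ×ˢ W).filter
          fun p => p.1 ≠ p.2 ∧ θ p.1 + θ p.2 ≠ 0) := by
      rw [mul_comm]
      refine Finset.mul_card_image_le_card_of_maps_to (f := Prod.fst) (fun p hp => ?_) _
        fun i hi => ?_
      · exact (Finset.mem_product.1 (Finset.mem_filter.1 hp).1).1
      · have hi0 : θ i ≠ 0 := (Finset.mem_filter.1 hi).2
        have hi1 := hmaj (-θ i) (neg_ne_zero.2 hi0)
        have hsplit := Finset.card_filter_add_card_filter_not (s := W) (fun j => θ j = -θ i)
        have herase := Finset.pred_card_le_card_erase (s := {j ∈ W | ¬ θ j = -θ i}) (a := i)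
        refine le_trans ?_ (Finset.card_le_card_of_injOn
          (s := ({j ∈ W | ¬ θ j = -θ i}).erase i) (fun j => (i, j)) (fun j hj => ?_)
          fun a _ b _ h => (Prod.mk.inj h).2)
        · omega
        · simp only [Finset.coe_erase, Set.mem_sdiff, Finset.mem_coe, Finset.mem_filter,
            Set.mem_singleton_iff] at hj
          simp only [Finset.coe_filter, Finset.mem_filter, Finset.mem_product, Set.mem_ofPred_eq,
            Finset.mem_univ, true_and, and_true]
          exact ⟨⟨hi0, hj.1.1⟩, fun h => hj.2 h.symm,
            fun h => hj.1.2 (eq_neg_of_add_eq_zero_right h)⟩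
    have : #{v | θ v ≠ 0} * (2 * (n / 64)) = 2 * (#{v | θ v ≠ 0} * (n / 64)) := by ring
    omega

theorem abs_card_filter_edgeDegrees_mem_sub_le {V : Type*} [Fintype V] [DecidableEq V]
    {k : ℕ} (E : Finset (Sym2 V)) (η : ℝ)
    (hη : ∀ x : V → ZMod k,
      |(k : ℝ) ^ Fintype.card V * #{T ∈ E.powerset | edgeDegrees k T = x} - 2 ^ #E| ≤ 2 ^ #E * η)
    (S : Finset (V → ZMod k)) :
    |(k : ℝ) ^ Fintype.card V * #{T ∈ E.powerset | edgeDegrees k T ∈ S} - 2 ^ #E * #S| ≤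
      2 ^ #E * #S * η := by
  have h1 : #{T ∈ E.powerset | edgeDegrees k T ∈ S} =
      ∑ x ∈ S, #{T ∈ E.powerset | edgeDegrees k T = x} := by
    rw [Finset.card_eq_sum_card_fiberwise (f := edgeDegrees k) (t := S)
      (s := {T ∈ E.powerset | edgeDegrees k T ∈ S}) (fun T hT => (Finset.mem_filter.1 hT).2)]
    refine Finset.sum_congr rfl fun x hx => ?_
    rw [Finset.filter_filter]
    congr 1
    refine Finset.filter_congr fun T _ => ?_
    exact ⟨fun h => h.2, fun h => ⟨h ▸ hx, h⟩⟩
  have h2 : (k : ℝ) ^ Fintype.card V * #{T ∈ E.powerset | edgeDegrees k T ∈ S} - 2 ^ #E * #S =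
      ∑ x ∈ S, ((k : ℝ) ^ Fintype.card V * #{T ∈ E.powerset | edgeDegrees k T = x} - 2 ^ #E) := by
    rw [h1, Finset.sum_sub_distrib, ← Finset.mul_sum, Finset.sum_const, nsmul_eq_mul]
    push_cast
    ring
  rw [h2]
  refine (Finset.abs_sum_le_sum_abs _ _).trans ((Finset.sum_le_sum fun x _ => hη x).trans ?_)
  rw [Finset.sum_const, nsmul_eq_mul]
  exact le_of_eq (by ring)

theorem exists_forall_one_add_mul_pow_sub_one_le (k : ℕ) {c : ℝ} (hc : 0 < c) (hc1 : c < 1)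
    {η : ℝ} (hη : 0 < η) :
    ∃ N : ℕ, ∀ n ≥ N, (1 + ((k : ℝ) - 1) * c ^ (n / 64)) ^ n - 1 ≤ η := by
  have h1 : Filter.Tendsto (fun n : ℕ => (n : ℝ) * c ^ n) Filter.atTop (nhds 0) :=
    tendsto_self_mul_const_pow_of_lt_one hc.le hc1
  have h2 : Filter.Tendsto (fun n : ℕ => c ^ n) Filter.atTop (nhds 0) :=
    tendsto_pow_atTop_nhds_zero_of_lt_one hc.le hc1
  have h3 : Filter.Tendsto (fun m : ℕ => Real.exp ((64 * ((m : ℝ) * c ^ m) + 64 * c ^ m) * k))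
      Filter.atTop (nhds 1) := by
    have := (((h1.const_mul 64).add (h2.const_mul 64)).mul_const (k : ℝ)).rexp
    simpa using this
  obtain ⟨M, hM⟩ := Filter.eventually_atTop.1
    (h3.eventually_le_const (show (1 : ℝ) < 1 + η by linarith))
  refine ⟨64 * M, fun n hn => ?_⟩
  have hm := hM (n / 64) (by omega)
  have hpos : 0 < c ^ (n / 64) := by positivity
  have hle1 : c ^ (n / 64) ≤ 1 := pow_le_one₀ hc.le hc1.le
  have hnle : (n : ℝ) ≤ 64 * ((n / 64 : ℕ) : ℝ) + 64 := by
    have : n ≤ 64 * (n / 64) + 64 := by omega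
    exact_mod_cast this
  have hk0 : (0 : ℝ) ≤ k := by positivity
  have hb0 : 0 ≤ 1 + ((k : ℝ) - 1) * c ^ (n / 64) := by nlinarith
  have hb1 : 1 + ((k : ℝ) - 1) * c ^ (n / 64) ≤ Real.exp (k * c ^ (n / 64)) := by
    have := Real.add_one_le_exp ((k : ℝ) * c ^ (n / 64))
    linarith
  have h4 : (1 + ((k : ℝ) - 1) * c ^ (n / 64)) ^ n ≤ Real.exp (n * (k * c ^ (n / 64))) := by
    rw [Real.exp_nat_mul]
    exact pow_le_pow_left₀ hb0 hb1 n
  have h5 : (n : ℝ) * (k * c ^ (n / 64)) ≤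
      (64 * (((n / 64 : ℕ) : ℝ) * c ^ (n / 64)) + 64 * c ^ (n / 64)) * k := by
    have := mul_le_mul_of_nonneg_right hnle (mul_nonneg hk0 hpos.le)
    linarith
  have := Real.exp_le_exp.2 h5
  linarith

theorem card_simpleGraph (V : Type*) [Finite V] :
    Nat.card (SimpleGraph V) = 2 ^ (Nat.card V).choose 2 := by
  classical
  have := Fintype.ofFinite V
  rw [Nat.card_eq_fintype_card, Nat.card_eq_fintype_card,
    ← SimpleGraph.card_edgeFinset_top_eq_card_choose_two, ← Finset.card_powerset,
    ← Finset.card_univ]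
  refine Finset.card_nbij' (fun G => G.edgeFinset)
    (fun T => SimpleGraph.fromEdgeSet (T : Set (Sym2 V))) ?_ ?_ ?_ ?_
  · intro G _
    simp only [Finset.coe_powerset, Set.mem_preimage, Set.mem_powerset_iff, Finset.coe_subset]
    exact SimpleGraph.edgeFinset_mono le_top
  · intro T _
    simp
  · intro G _
    simp
  · intro T hT
    ext e
    have h : ∀ e ∈ T, ¬ e.IsDiag := fun e he => by
      have := Finset.mem_powerset.1 hT he
      simpa using this
    simp only [SimpleGraph.mem_edgeFinset, SimpleGraph.edgeSet_fromEdgeSet, Set.mem_sdiff,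
      Finset.mem_coe, Sym2.mem_diagSet]
    exact ⟨fun h' => h'.1, fun h' => ⟨h', h e h'⟩⟩

open Classical in
theorem natCast_ndeg {V : Type*} [Fintype V] [DecidableEq V] (k : ℕ) (G : SimpleGraph V) (v : V) :
    (ndeg G v : ZMod k) = edgeDegrees k G.edgeFinset v := by
  rw [ndeg, Nat.card_eq_fintype_card, SimpleGraph.card_neighborSet_eq_degree,
    ← SimpleGraph.card_incidenceFinset_eq_degree, SimpleGraph.incidenceFinset_eq_filter,
    edgeDegrees, Finset.sum_boole]

/-- The pairs of distinct vertices not contained in `U`. -/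
noncomputable def crossingPairs {n : ℕ} (U : Set (Fin n)) : Finset (Sym2 (Fin n)) := by
  classical exact {e | ¬ e.IsDiag ∧ ∃ v ∈ e, v ∉ U}

theorem mem_crossingPairs {n : ℕ} {U : Set (Fin n)} {i j : Fin n} :
    s(i, j) ∈ crossingPairs U ↔ i ≠ j ∧ (i ∉ U ∨ j ∉ U) := by
  simp [crossingPairs]

theorem edgeDegrees_union {V : Type*} [DecidableEq V] (k : ℕ) {S T : Finset (Sym2 V)}
    (h : Disjoint S T) : edgeDegrees k (S ∪ T) = edgeDegrees k S + edgeDegrees k T := by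
  funext v
  exact Finset.sum_union h

open Classical in
/-- The degree vectors `x` such that `x + d` vanishes exactly on `U`. -/
noncomputable def vanishingOn {n : ℕ} (k : ℕ) [NeZero k] (U : Set (Fin n))
    (d : Fin n → ZMod k) : Finset (Fin n → ZMod k) :=
  Fintype.piFinset fun v => if v ∈ U then {-d v} else univ.erase (-d v)

theorem mem_vanishingOn {n k : ℕ} [NeZero k] {U : Set (Fin n)} {d x : Fin n → ZMod k} :
    x ∈ vanishingOn k U d ↔ ∀ v, x v + d v = 0 ↔ v ∈ U := by
  rw [vanishingOn, Fintype.mem_piFinset]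
  refine forall_congr' fun v => ?_
  by_cases h : v ∈ U <;> simp [h, eq_neg_iff_add_eq_zero]

open Classical in
theorem card_vanishingOn {n k : ℕ} [NeZero k] (U : Set (Fin n)) (d : Fin n → ZMod k) :
    #(vanishingOn k U d) = (k - 1) ^ #{v : Fin n | v ∉ U} := by
  rw [vanishingOn, Fintype.card_piFinset, ← Finset.prod_const, Finset.prod_filter]
  refine Finset.prod_congr rfl fun v _ => ?_
  by_cases h : v ∈ U <;> simp [h, Finset.card_erase_of_mem, ZMod.card]

theorem exists_card_fiber_eq {n : ℕ} (k : ℕ) [NeZero k] (U : Set (Fin n)) (H : SimpleGraph U) :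
    ∃ d : Fin n → ZMod k,
      Nat.card {G : SimpleGraph (Fin n) | G.induce U = H ∧ divisorSet k G = U} =
        #{T ∈ (crossingPairs U).powerset | edgeDegrees k T ∈ vanishingOn k U d} := by
  classical
  set F := (H.map (Function.Embedding.subtype (· ∈ U))).edgeFinset with hF
  have hmemF : ∀ i j, s(i, j) ∈ F ↔ ∃ (hi : i ∈ U) (hj : j ∈ U), H.Adj ⟨i, hi⟩ ⟨j, hj⟩ := by
    intro i j
    simp only [hF, SimpleGraph.mem_edgeFinset, SimpleGraph.mem_edgeSet, SimpleGraph.map_adj]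
    constructor
    · rintro ⟨⟨a, ha⟩, ⟨b, hb⟩, hab, rfl, rfl⟩
      exact ⟨ha, hb, hab⟩
    · rintro ⟨hi, hj, h⟩
      exact ⟨_, _, h, rfl, rfl⟩
  have hdisj : Disjoint (crossingPairs U) F := by
    rw [Finset.disjoint_left]
    intro e
    induction e using Sym2.ind with
    | _ i j =>
      rw [mem_crossingPairs, hmemF]
      rintro ⟨_, h⟩ ⟨hi, hj, _⟩
      tauto
  have hdec : ∀ G : SimpleGraph (Fin n), G.induce U = H →
      G.edgeFinset = (crossingPairs U ∩ G.edgeFinset) ∪ F := by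
    rintro G rfl
    ext e
    induction e using Sym2.ind with
    | _ i j =>
      simp only [Finset.mem_union, Finset.mem_inter, mem_crossingPairs, hmemF,
        SimpleGraph.mem_edgeFinset, SimpleGraph.mem_edgeSet, SimpleGraph.comap_adj,
        Function.Embedding.subtype_apply, exists_prop]
      constructor
      · intro h
        have := h.ne
        tauto
      · tauto
  have hdiv : ∀ (G : SimpleGraph (Fin n)) (T : Finset (Sym2 (Fin n))), T ⊆ crossingPairs U →
      G.edgeFinset = T ∪ F →
      (divisorSet k G = U ↔ edgeDegrees k T ∈ vanishingOn k U (edgeDegrees k F)) := by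
    intro G T hT hG
    rw [mem_vanishingOn, Set.ext_iff]
    refine forall_congr' fun v => ?_
    rw [divisorSet, Set.mem_ofPred_eq, ← ZMod.natCast_eq_zero_iff, natCast_ndeg, hG,
      edgeDegrees_union k (hdisj.mono_left hT), Pi.add_apply]
  obtain ⟨g, hg⟩ : ∃ g : Finset (Sym2 (Fin n)) → SimpleGraph (Fin n),
      ∀ T ⊆ crossingPairs U, (g T).edgeFinset = T ∪ F := by
    refine ⟨fun T => SimpleGraph.fromEdgeSet ((T ∪ F : Finset (Sym2 (Fin n))) :
      Set (Sym2 (Fin n))), fun T hT => ?_⟩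
    ext e
    induction e using Sym2.ind with
    | _ i j =>
      simp only [SimpleGraph.mem_edgeFinset, SimpleGraph.mem_edgeSet,
        SimpleGraph.fromEdgeSet_adj, Finset.mem_coe]
      refine ⟨fun h => h.1, fun h => ⟨h, ?_⟩⟩
      rcases Finset.mem_union.1 h with h | h
      · exact (mem_crossingPairs.1 (hT h)).1
      · obtain ⟨hi, hj, h⟩ := (hmemF i j).1 h
        exact fun hij => h.ne (Subtype.ext hij)
  refine ⟨edgeDegrees k F, ?_⟩
  rw [Nat.card_eq_fintype_card, ← Set.toFinset_card]
  refine Finset.card_nbij' (fun G => crossingPairs U ∩ G.edgeFinset)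
    g ?_ ?_ ?_ ?_
  · intro G hG
    simp only [Set.coe_toFinset, Set.mem_ofPred_eq] at hG
    simp only [Finset.coe_filter, Set.mem_ofPred_eq, Finset.mem_powerset]
    exact ⟨Finset.inter_subset_left,
      (hdiv G _ Finset.inter_subset_left (hdec G hG.1)).1 hG.2⟩
  · intro T hT
    simp only [Finset.coe_filter, Set.mem_ofPred_eq, Finset.mem_powerset] at hT
    simp only [Set.coe_toFinset, Set.mem_ofPred_eq]
    refine ⟨?_, (hdiv _ T hT.1 (hg T hT.1)).2 hT.2⟩
    ext ⟨i, hi⟩ ⟨j, hj⟩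
    rw [SimpleGraph.comap_adj, ← SimpleGraph.mem_edgeSet, ← SimpleGraph.mem_edgeFinset,
      hg T hT.1, Finset.mem_union]
    simp only [Function.Embedding.subtype_apply, hmemF, hi, hj, exists_true_left, or_iff_right_iff_imp]
    intro h
    have := (mem_crossingPairs.1 (hT.1 h)).2
    tauto
  · intro G hG
    simp only [Set.coe_toFinset, Set.mem_ofPred_eq] at hG
    rw [← SimpleGraph.edgeFinset_inj, hg _ Finset.inter_subset_left, ← hdec G hG.1]
  · intro T hT
    simp only [Finset.coe_filter, Set.mem_ofPred_eq, Finset.mem_powerset] at hT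
    simp only
    rw [hg T hT.1, Finset.inter_union_distrib_left, Finset.inter_eq_right.2 hT.1,
      Finset.disjoint_iff_inter_eq_empty.1 hdisj, Finset.union_empty]

open Classical in
theorem card_induce_mem_eq_sum {n : ℕ} (k : ℕ) (U : Set (Fin n)) (A : Set (SimpleGraph U)) :
    Nat.card {G : SimpleGraph (Fin n) | G.induce U ∈ A ∧ divisorSet k G = U} =
      ∑ H ∈ A.toFinset,
        Nat.card {G : SimpleGraph (Fin n) | G.induce U = H ∧ divisorSet k G = U} := by
  simp only [Nat.card_eq_fintype_card, ← Set.toFinset_card]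
  rw [Finset.card_eq_sum_card_fiberwise (f := fun G => G.induce U) (t := A.toFinset)
    (fun G hG => by simp at hG ⊢; exact hG.1)]
  refine Finset.sum_congr rfl fun H hH => ?_
  congr 1
  ext G
  simp only [Finset.mem_filter, Set.mem_toFinset, Set.mem_ofPred_eq]
  rw [Set.mem_toFinset] at hH
  constructor
  · rintro ⟨⟨_, h⟩, rfl⟩
    exact ⟨rfl, h⟩
  · rintro ⟨rfl, h⟩
    exact ⟨⟨hH, h⟩, rfl⟩

theorem exists_forall_abs_card_fiber_sub_le (k : ℕ) (hodd : Odd k) (hk : 1 < k) {η : ℝ}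
    (hη : 0 < η) :
    ∃ N : ℕ, ∀ n ≥ N, ∀ U : Set (Fin n), 2 * U.ncard ≤ n → ∃ L : ℝ, 0 ≤ L ∧
      ∀ H : SimpleGraph U,
        |(Nat.card {G : SimpleGraph (Fin n) | G.induce U = H ∧ divisorSet k G = U} : ℝ) - L| ≤
          η * L := by
  classical
  have : NeZero k := ⟨by omega⟩
  obtain ⟨c, hc, hc1, hck⟩ := norm_one_add_le_two_mul_of_ne_zero k hk
  obtain ⟨N, hN⟩ := exists_forall_one_add_mul_pow_sub_one_le k hc hc1 hη
  refine ⟨max N 64, fun n hn U hU => ?_⟩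
  have hkn : (0 : ℝ) < (k : ℝ) ^ n := by positivity
  refine ⟨2 ^ #(crossingPairs U) * ((k - 1) ^ #{v : Fin n | v ∉ U} : ℕ) / (k : ℝ) ^ n,
    by positivity, fun H => ?_⟩
  obtain ⟨d, hd⟩ := exists_card_fiber_eq k U H
  have hW : n ≤ 2 * #{v : Fin n | v ∉ U} := by
    have h1 := Finset.card_filter_add_card_filter_not (s := (univ : Finset (Fin n))) (fun v => v ∈ U)
    have h2 : U.ncard = #{v : Fin n | v ∈ U} := by
      rw [← Set.ncard_coe_finset]
      simp
    rw [Finset.card_univ, Fintype.card_fin] at h1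
    omega
  have hbad := card_nonzero_mul_le_card_endpointSum_ne_zero hodd (le_of_max_le_right hn)
    {v : Fin n | v ∉ U} hW (crossingPairs U)
    (fun i j hij hi => mem_crossingPairs.2 ⟨hij, Or.inl (by simpa using hi)⟩)
  have hmain := abs_card_filter_edgeDegrees_mem_sub_le (crossingPairs U) η (fun x =>
    (abs_card_filter_edgeDegrees_sub_le hc hc1 hck (crossingPairs U) (n / 64) hbad x).trans
      (mul_le_mul_of_nonneg_left (by simpa using hN n (le_of_max_le_left hn)) (by positivity)))
    (vanishingOn k U d)
  rw [← hd, card_vanishingOn, Fintype.card_fin] at hmain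
  rw [← mul_le_mul_iff_right₀ hkn]
  calc _ = _ := by
        rw [← abs_of_pos hkn, ← abs_mul, abs_of_pos hkn, mul_sub, mul_div_cancel₀ _ hkn.ne']
    _ ≤ _ := hmain
    _ = _ := by field_simp

theorem abs_sub_mul_le_of_abs_sub_le {δ η a x p q : ℝ} (ha : 0 ≤ a) (hx : 0 ≤ x)
    (hη : 0 ≤ η) (hη1 : η ≤ 1 / 4) (hηδ : η ≤ δ / 4)
    (hp : |p - a * x| ≤ η * (a * x)) (hq : |q - x| ≤ η * x) :
    |p - a * q| ≤ δ * (a * q) := by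
  have h1 : |p - a * q| ≤ 2 * η * (a * x) := by
    have : p - a * q = (p - a * x) - a * (q - x) := by ring
    rw [this]
    refine (abs_sub _ _).trans ?_
    rw [abs_mul, abs_of_nonneg ha]
    have := mul_le_mul_of_nonneg_left hq ha
    linarith
  have h2 : x ≤ 2 * q := by
    have := (abs_le.1 hq).1
    nlinarith
  have h3 : a * x ≤ 2 * (a * q) := by nlinarith
  have h4 : 2 * η * (a * x) ≤ 2 * η * (2 * (a * q)) :=
    mul_le_mul_of_nonneg_left h3 (by positivity)
  have h5 : 0 ≤ a * q := by
    have := mul_nonneg ha hx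
    linarith
  nlinarith

theorem exists_forall_abs_gprob_sub_le (k : ℕ) (hodd : Odd k) (hk : 1 < k) {δ : ℝ}
    (hδ : 0 < δ) :
    ∃ N : ℕ, ∀ n ≥ N, ∀ U : Set (Fin n), 2 * U.ncard ≤ n → ∀ A : Set (SimpleGraph U),
      |gprob {G : SimpleGraph (Fin n) | G.induce U ∈ A ∧ divisorSet k G = U}
          - gprob A * gprob {G : SimpleGraph (Fin n) | divisorSet k G = U}|
        ≤ δ * (gprob A * gprob {G : SimpleGraph (Fin n) | divisorSet k G = U}) := by
  classical
  have hη : 0 < min 1 δ / 4 := by positivity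
  obtain ⟨N, hN⟩ := exists_forall_abs_card_fiber_sub_le k hodd hk hη
  refine ⟨N, fun n hn U hU A => ?_⟩
  obtain ⟨L, hL, hfib⟩ := hN n hn U hU
  set η := min 1 δ / 4
  have hsum : ∀ B : Set (SimpleGraph U),
      |gprob {G : SimpleGraph (Fin n) | G.induce U ∈ B ∧ divisorSet k G = U} -
        gprob B * (2 ^ (Nat.card U).choose 2 * L / 2 ^ (Nat.card (Fin n)).choose 2)| ≤
      η * (gprob B * (2 ^ (Nat.card U).choose 2 * L / 2 ^ (Nat.card (Fin n)).choose 2)) := by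
    intro B
    have h1 : |((∑ H ∈ B.toFinset,
        Nat.card {G : SimpleGraph (Fin n) | G.induce U = H ∧ divisorSet k G = U} : ℕ) : ℝ) -
          Nat.card B * L| ≤ η * (Nat.card B * L) := by
      have h2 : (Nat.card B : ℝ) * L = ∑ H ∈ B.toFinset, L := by
        rw [Finset.sum_const, nsmul_eq_mul, Set.toFinset_card, Nat.card_eq_fintype_card]
      rw [h2, Nat.cast_sum, ← Finset.sum_sub_distrib, Finset.mul_sum]
      exact (Finset.abs_sum_le_sum_abs _ _).trans (Finset.sum_le_sum fun H _ => hfib H)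
    rw [← card_induce_mem_eq_sum] at h1
    have h3 : gprob B * (2 ^ (Nat.card U).choose 2 * L / 2 ^ (Nat.card (Fin n)).choose 2) =
        Nat.card B * L / 2 ^ (Nat.card (Fin n)).choose 2 := by
      rw [gprob]
      field_simp
    rw [h3, gprob, ← sub_div, abs_div, abs_of_pos (a := (2 : ℝ) ^ (Nat.card (Fin n)).choose 2)
      (by positivity), ← mul_div_assoc]
    gcongr
  have huniv := hsum Set.univ
  have hg : gprob (Set.univ : Set (SimpleGraph U)) = 1 := by
    rw [gprob, Nat.card_coe_set_eq, Set.ncard_univ, card_simpleGraph]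
    push_cast
    exact div_self (by positivity)
  simp only [Set.mem_univ, true_and, hg, one_mul] at huniv
  refine abs_sub_mul_le_of_abs_sub_le (by unfold gprob; positivity) (by positivity) hη.le
    ?_ ?_ (hsum A) huniv
  · have := min_le_left 1 δ
    simp only [η]; linarith
  · have := min_le_right 1 δ
    simp only [η]; linarith

/-- Conditioned on `U(G_n) = U`, the induced subgraph `G_n|_U` is almost uniformly
distributed (part 1 of the key lemma). -/
theorem induced_subgraph_almost_uniform_on_U
    (k : ℕ) (hodd : Odd k) (hk : 11 < k) (hdvd : ¬ (11 ∣ k))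
    (ε : ℝ) (hε : ε ∈ Set.Ioo (0 : ℝ) 1) (δ : ℝ) (hδ : 0 < δ) :
    ∃ N : ℕ, ∀ n ≥ N, ∀ U : Fin 11 → Set (Fin n),
      Pairwise (Function.onFun Disjoint U) →
      (∀ i, (n : ℝ) * (1 - ε) / (11 * k) < ((U i).ncard : ℝ) ∧
            ((U i).ncard : ℝ) < (n : ℝ) * (1 + ε) / (11 * k)) →
      ∀ A : Set (SimpleGraph ↥(⋃ i, U i)),
        |gprob {G : SimpleGraph (Fin n) |
            G.induce (⋃ i, U i) ∈ A ∧ divisorSet k G = ⋃ i, U i}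
          - gprob A * gprob {G : SimpleGraph (Fin n) | divisorSet k G = ⋃ i, U i}|
        ≤ δ * (gprob A * gprob {G : SimpleGraph (Fin n) | divisorSet k G = ⋃ i, U i}) := by
  obtain ⟨N, hN⟩ := exists_forall_abs_gprob_sub_le k hodd (by omega) hδ
  refine ⟨N, fun n hn U _ hU A => hN n hn _ ?_ A⟩
  have h1 : (⋃ i, U i).ncard ≤ ∑ i, (U i).ncard := by
    simpa using Finset.set_ncard_biUnion_le Finset.univ U
  have h2 : ∀ i, ((U i).ncard : ℝ) ≤ n / 66 := by
    intro i
    refine (hU i).2.le.trans ?_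
    have hk' : (12 : ℝ) ≤ k := by exact_mod_cast hk
    have hε1 := hε.2
    have hn0 : (0 : ℝ) ≤ n := by positivity
    rw [div_le_div_iff₀ (by positivity) (by norm_num)]
    nlinarith
  have h3 : ((∑ i, (U i).ncard : ℕ) : ℝ) ≤ n / 6 := by
    push_cast
    refine (Finset.sum_le_sum fun i _ => h2 i).trans ?_
    simp
    linarith
  have h4 : ((⋃ i, U i).ncard : ℝ) ≤ n / 6 := le_trans (by exact_mod_cast h1) h3
  have h5 : (2 * (⋃ i, U i).ncard : ℝ) ≤ n := by
    have hn0 : (0 : ℝ) ≤ n := by positivity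
    linarith
  exact_mod_cast h5
end

section
/- Fix an odd integer k > 11 not divisible by 11. Then n³ · P[ | |U(G_n)| − n/k | > √n · ln n ] → 0 as n → ∞; in other words, the number of vertices of G_n whose degree is divisible by k lies within √n · ln n of n/k with probability 1 − o(1/n³). -/
open Filter

open Finset

theorem exists_abs_divisible_card_sub_le (k : ℕ) (hk : 2 ≤ k) :
    ∃ r : ℝ, 0 ≤ r ∧ r < 1 ∧ ∀ {V : Type} (B : Finset V) (c : ℕ),
      |(#{S ∈ B.powerset | k ∣ c + #S} : ℝ) / 2 ^ #B - 1 / k| ≤ r ^ #B := by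
  have hk0 : k ≠ 0 := by omega
  have hζ := Complex.isPrimitiveRoot_exp k hk0
  set ζ := Complex.exp (2 * Real.pi * Complex.I / k)
  have hn : ‖ζ‖ = 1 := hζ.norm'_eq_one hk0
  obtain ⟨j₀, hj₀, hmax⟩ := Finset.exists_max_image (Ico 1 k) (fun j => ‖1 + ζ ^ j‖)
    ⟨1, by simp; omega⟩
  refine ⟨‖1 + ζ ^ j₀‖ / 2, by positivity, ?_, ?_⟩
  · have h1 : ‖1 + ζ ^ j₀‖ ≤ 2 := by
      refine (norm_add_le _ _).trans ?_
      simp [hn]; norm_num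
    have h2 : ‖1 + ζ ^ j₀‖ ≠ 2 := by
      intro h
      have := eq_of_norm_eq_of_norm_add_eq (x := (1 : ℂ)) (y := ζ ^ j₀) (by simp [hn])
        (by rw [h]; simp [hn]; norm_num)
      rw [eq_comm, hζ.pow_eq_one_iff_dvd] at this
      have := Nat.le_of_dvd (by simp at hj₀; omega) this
      simp at hj₀; omega
    have := lt_of_le_of_ne h1 h2
    linarith
  intro V B c
  set m := #B
  set N := #{S ∈ B.powerset | k ∣ c + #S} with hN
  have hfilter : ∀ x : ℕ, ∑ j ∈ range k, ζ ^ (j * x) = if k ∣ x then (k : ℂ) else 0 := by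
    intro x
    simp_rw [mul_comm _ x, pow_mul]
    split_ifs with h
    · simp [(hζ.pow_eq_one_iff_dvd x).2 h]
    · have h1 : ζ ^ x ≠ 1 := fun h' => h ((hζ.pow_eq_one_iff_dvd x).1 h')
      rw [geom_sum_eq h1, ← pow_mul, mul_comm, pow_mul, hζ.pow_eq_one]
      simp
  have hmain : (k : ℂ) * N = ∑ j ∈ range k, ζ ^ (j * c) * (1 + ζ ^ j) ^ m := by
    calc (k : ℂ) * N = ∑ S ∈ B.powerset, if k ∣ c + #S then (k : ℂ) else 0 := by
          rw [← Finset.sum_filter, Finset.sum_const, nsmul_eq_mul, mul_comm]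
      _ = ∑ j ∈ range k, ∑ S ∈ B.powerset, ζ ^ (j * (c + #S)) := by
          rw [Finset.sum_comm]
          exact Finset.sum_congr rfl fun S _ => (hfilter _).symm
      _ = _ := by
          refine Finset.sum_congr rfl fun j _ => ?_
          have := Finset.sum_pow_mul_eq_add_pow (ζ ^ j) (1 : ℂ) B
          rw [add_comm 1, ← this, Finset.mul_sum]
          refine Finset.sum_congr rfl fun S _ => ?_
          simp [mul_add, pow_add, pow_mul]
  have hsub : (k : ℂ) * N - 2 ^ m = ∑ j ∈ Ico 1 k, ζ ^ (j * c) * (1 + ζ ^ j) ^ m := by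
    rw [hmain, Finset.range_eq_Ico, Finset.sum_eq_sum_Ico_succ_bot (by omega)]
    norm_num
  have hbound : |(k : ℝ) * N - 2 ^ m| ≤ k * ‖1 + ζ ^ j₀‖ ^ m := by
    have : |(k : ℝ) * N - 2 ^ m| = ‖(k : ℂ) * N - 2 ^ m‖ := by
      rw [← Real.norm_eq_abs, ← Complex.norm_real]; push_cast; rfl
    rw [this, hsub]
    calc _ ≤ ∑ j ∈ Ico 1 k, ‖1 + ζ ^ j₀‖ ^ m := by
          refine norm_sum_le_of_le _ fun j hj => ?_
          rw [norm_mul, norm_pow, norm_pow, hn, one_pow, one_mul]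
          exact pow_le_pow_left₀ (norm_nonneg _) (hmax j hj) _
      _ ≤ _ := by
          rw [Finset.sum_const, nsmul_eq_mul]
          gcongr
          simp
  have hkpos : (0 : ℝ) < k := by positivity
  have : (N : ℝ) / 2 ^ m - 1 / k = (k * N - 2 ^ m) / (k * 2 ^ m) := by
    field_simp
  rw [this, abs_div, abs_of_pos (by positivity : (0 : ℝ) < k * 2 ^ m), div_pow,
    div_le_div_iff₀ (by positivity) (by positivity)]
  calc _ ≤ (k * ‖1 + ζ ^ j₀‖ ^ m) * 2 ^ m := by gcongr
    _ = _ := by ring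

theorem card_simpleGraph_eq (V : Type*) [Fintype V] :
    Nat.card (SimpleGraph V) = 2 ^ (Nat.card V).choose 2 := by
  classical
  let e : SimpleGraph V ≃ Set {e : Sym2 V // ¬ e.IsDiag} :=
    { toFun := fun G => {x | x.1 ∈ G.edgeSet}
      invFun := fun s => SimpleGraph.fromEdgeSet (Subtype.val '' s)
      left_inv := by
        intro G
        ext a b
        simp only [SimpleGraph.fromEdgeSet_adj, Set.mem_image, Set.mem_ofPred_eq, Subtype.exists,
          exists_and_left, exists_prop, exists_eq_right_right, SimpleGraph.mem_edgeSet]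
        constructor
        · rintro ⟨h, _⟩; simpa using h.1
        · intro h; exact ⟨by simpa [h.ne] using h, h.ne⟩
      right_inv := by
        intro s
        ext ⟨x, hx⟩
        simp [hx, SimpleGraph.edgeSet_fromEdgeSet] }
  rw [Nat.card_congr e, Nat.card_eq_fintype_card, Fintype.card_set, Sym2.card_subtype_not_diag,
    Nat.card_eq_fintype_card]

theorem sum_exp_indicator_le {α : Type*} (s : Finset α) (P : α → Prop) [DecidablePred P]
    {p δ l : ℝ} (hp0 : 0 ≤ p) (hp1 : p ≤ 1) (hl : |l| ≤ 1)
    (hs : |(#{x ∈ s | P x} : ℝ) / #s - p| ≤ δ) :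
    ∑ x ∈ s, Real.exp (l * ((if P x then 1 else 0) - p)) ≤
      #s * Real.exp (|l| * δ + l ^ 2) := by
  obtain rfl | hne := s.eq_empty_or_nonempty
  · simp
  have hcard : (0 : ℝ) < #s := by exact_mod_cast hne.card_pos
  have hpt : ∀ y : ℝ, |y| ≤ 1 → Real.exp (l * y) ≤ 1 + l * y + l ^ 2 := by
    intro y hy
    have h1 : |l * y| ≤ 1 := by rw [abs_mul]; exact mul_le_one₀ hl (abs_nonneg _) hy
    have h2 := (abs_le.1 (Real.abs_exp_sub_one_sub_id_le h1)).2
    have h3 : (l * y) ^ 2 ≤ l ^ 2 := by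
      rw [mul_pow]
      exact mul_le_of_le_one_right (sq_nonneg _) ((sq_le_one_iff_abs_le_one _).2 hy)
    linarith
  calc _ ≤ ∑ x ∈ s, (1 + l * ((if P x then 1 else 0) - p) + l ^ 2) := by
        refine Finset.sum_le_sum fun x _ => hpt _ ?_
        split_ifs <;> rw [abs_le] <;> constructor <;> linarith
    _ = #s * (l * ((#{x ∈ s | P x} : ℝ) / #s - p) + l ^ 2 + 1) := by
        simp only [Finset.sum_add_distrib, ← Finset.mul_sum, Finset.sum_sub_distrib,
          Finset.sum_boole, Finset.sum_const, nsmul_eq_mul]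
        field_simp
        ring
    _ ≤ #s * (|l| * δ + l ^ 2 + 1) := by
        refine mul_le_mul_of_nonneg_left ?_ hcard.le
        gcongr ?_ + _ + _
        calc _ ≤ |l * ((#{x ∈ s | P x} : ℝ) / #s - p)| := le_abs_self _
          _ ≤ _ := by rw [abs_mul]; gcongr
    _ ≤ _ := by gcongr; exact Real.add_one_le_exp _

/-- The graph joining each `a ∈ A` to the vertices of `S a` outside `A`. -/
def crossGraph {V : Type*} (A : Finset V) (S : A → Finset V) : SimpleGraph V where
  Adj a b := (∃ h : a ∈ A, b ∉ A ∧ b ∈ S ⟨a, h⟩) ∨ ∃ h : b ∈ A, a ∉ A ∧ a ∈ S ⟨b, h⟩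
  symm := ⟨fun _ _ h => h.symm⟩
  loopless := ⟨fun a h => by rcases h with ⟨h, h', _⟩ | ⟨h, h', _⟩ <;> exact h' h⟩

open Classical in
theorem ndeg_symmDiff_crossGraph {V : Type*} [Fintype V] (A : Finset V) (S : A → Finset V)
    (hS : ∀ a, S a ⊆ Aᶜ) (G : SimpleGraph V) (a : A) :
    ndeg (symmDiff G (crossGraph A S)) a =
      #{w ∈ A | G.Adj a w} + #(symmDiff {w ∈ Aᶜ | G.Adj a w} (S a)) := by
  have hadj : ∀ w, (crossGraph A S).Adj a w ↔ w ∈ S a := by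
    intro w
    have ha := a.2
    have hw : w ∈ S a → w ∉ A := fun h => Finset.mem_compl.1 (hS a h)
    simp only [crossGraph]
    constructor
    · rintro (⟨_, _, h⟩ | ⟨_, h, _⟩)
      · exact h
      · exact absurd ha h
    · exact fun h => Or.inl ⟨ha, hw h, h⟩
  rw [← Finset.card_union_of_disjoint]
  · rw [ndeg, Nat.card_coe_set_eq, ← Set.ncard_coe_finset]
    congr 1
    ext w
    have hw : w ∈ S a → w ∉ A := fun h => Finset.mem_compl.1 (hS a h)
    simp only [SimpleGraph.mem_neighborSet, symmDiff, SimpleGraph.sup_adj, SimpleGraph.sdiff_adj,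
      hadj, Finset.coe_union, Set.mem_union, Finset.mem_coe, Finset.mem_filter, Finset.sup_eq_union,
      Finset.mem_sdiff, Finset.mem_compl]
    tauto
  · rw [Finset.disjoint_left]
    intro w hw hw'
    simp only [Finset.mem_symmDiff, Finset.mem_filter, Finset.mem_compl] at hw hw'
    rcases hw' with ⟨⟨h, _⟩, _⟩ | ⟨h, _⟩
    · exact h hw.1
    · exact Finset.mem_compl.1 (hS a h) hw.1

open Classical in
theorem sum_exp_divisible_degrees_le {V : Type*} [Fintype V] (A : Finset V) (k : ℕ)
    {p δ l : ℝ} (hp0 : 0 ≤ p) (hp1 : p ≤ 1) (hl : |l| ≤ 1)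
    (hδ : ∀ c : ℕ, |(#{S ∈ Aᶜ.powerset | k ∣ c + #S} : ℝ) / 2 ^ #Aᶜ - p| ≤ δ) :
    ∑ G : SimpleGraph V, Real.exp (l * ((#{v ∈ A | k ∣ ndeg G v} : ℝ) - #A * p)) ≤
      Nat.card (SimpleGraph V) * Real.exp (#A * (|l| * δ + l ^ 2)) := by
  set f : ℕ → ℝ := fun d => Real.exp (l * ((if k ∣ d then 1 else 0) - p)) with hf
  have hprod : ∀ G : SimpleGraph V,
      Real.exp (l * ((#{v ∈ A | k ∣ ndeg G v} : ℝ) - #A * p)) = ∏ a : A, f (ndeg G a) := by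
    intro G
    rw [hf, ← Real.exp_sum, ← Finset.mul_sum, Finset.sum_sub_distrib,
      Finset.sum_coe_sort A (fun v => if k ∣ ndeg G v then (1 : ℝ) else 0), Finset.sum_boole]
    simp
  simp_rw [hprod]
  set T := Fintype.piFinset fun _ : A => Aᶜ.powerset
  have hT : (#T : ℝ) = (2 ^ #Aᶜ) ^ #A := by
    simp [T, Fintype.card_piFinset]
  have hfactor : ∀ (G : SimpleGraph V) (a : A),
      ∑ S ∈ Aᶜ.powerset, f (#{w ∈ A | G.Adj a w} + #(symmDiff {w ∈ Aᶜ | G.Adj a w} S)) ≤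
        2 ^ #Aᶜ * Real.exp (|l| * δ + l ^ 2) := by
    intro G a
    set c := #{w ∈ A | G.Adj a w}
    have hD : {w ∈ Aᶜ | G.Adj a w} ⊆ Aᶜ := Finset.filter_subset _ _
    set D := {w ∈ Aᶜ | G.Adj a w}
    have hmem : ∀ S ∈ Aᶜ.powerset, symmDiff D S ∈ Aᶜ.powerset := fun S hS =>
      Finset.mem_powerset.2 (symmDiff_le_sup.trans (sup_le hD (Finset.mem_powerset.1 hS)))
    have : ∑ S ∈ Aᶜ.powerset, f (c + #(symmDiff D S)) = ∑ S ∈ Aᶜ.powerset, f (c + #S) :=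
      Finset.sum_bij' (fun S _ => symmDiff D S) (fun S _ => symmDiff D S) hmem hmem
        (fun S _ => symmDiff_symmDiff_cancel_left D S)
        (fun S _ => symmDiff_symmDiff_cancel_left D S) (fun S _ => rfl)
    rw [this]
    have h := sum_exp_indicator_le Aᶜ.powerset (fun S => k ∣ c + #S) hp0 hp1 hl
      (by simpa using hδ c)
    simpa using h
  have hshift : ∀ S : A → Finset V, ∑ G : SimpleGraph V, ∏ a : A, f (ndeg G a) =
      ∑ G : SimpleGraph V, ∏ a : A, f (ndeg (symmDiff G (crossGraph A S)) a) := fun S =>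
    (Equiv.sum_comp (symmDiff_left_involutive (crossGraph A S)).toPerm
      (fun G : SimpleGraph V => ∏ a : A, f (ndeg G a))).symm
  have hTpos : (0 : ℝ) < #T := by rw [hT]; positivity
  refine le_of_mul_le_mul_left ?_ hTpos
  calc (#T : ℝ) * ∑ G : SimpleGraph V, ∏ a : A, f (ndeg G a)
      = ∑ S ∈ T, ∑ G : SimpleGraph V,
          ∏ a : A, f (ndeg (symmDiff G (crossGraph A S)) a) := by
        rw [← Finset.sum_congr rfl fun S _ => hshift S, Finset.sum_const, nsmul_eq_mul]
    _ = ∑ G : SimpleGraph V, ∏ a : A, ∑ S ∈ Aᶜ.powerset,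
          f (#{w ∈ A | G.Adj a w} + #(symmDiff {w ∈ Aᶜ | G.Adj a w} S)) := by
        rw [Finset.sum_comm]
        refine Finset.sum_congr rfl fun G _ => ?_
        rw [Finset.prod_univ_sum]
        refine Finset.sum_congr rfl fun S hS => Finset.prod_congr rfl fun a _ => ?_
        rw [ndeg_symmDiff_crossGraph A S fun a =>
          Finset.mem_powerset.1 (Fintype.mem_piFinset.1 hS a)]
    _ ≤ ∑ G : SimpleGraph V, ∏ a : A, (2 ^ #Aᶜ * Real.exp (|l| * δ + l ^ 2)) := by
        refine Finset.sum_le_sum fun G _ => Finset.prod_le_prod (fun a _ => ?_)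
          fun a _ => hfactor G a
        exact Finset.sum_nonneg fun S _ => (Real.exp_pos _).le
    _ = _ := by
        rw [hT]
        simp only [Finset.prod_const, Finset.sum_const, Finset.card_univ, Fintype.card_coe,
          mul_pow, ← Real.exp_nat_mul, nsmul_eq_mul, Nat.card_eq_fintype_card]
        ring

open Classical in
theorem gprob_divisible_degrees_deviation_le {V : Type*} [Fintype V] (A : Finset V) (k : ℕ)
    {p δ l t : ℝ} (hp0 : 0 ≤ p) (hp1 : p ≤ 1) (hl0 : 0 ≤ l) (hl : l ≤ 1)
    (hδ0 : 0 ≤ δ)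
    (hA : ∀ c : ℕ, |(#{S ∈ A.powerset | k ∣ c + #S} : ℝ) / 2 ^ #A - p| ≤ δ)
    (hAc : ∀ c : ℕ, |(#{S ∈ Aᶜ.powerset | k ∣ c + #S} : ℝ) / 2 ^ #Aᶜ - p| ≤ δ) :
    gprob {G : SimpleGraph V | t < |(({v | k ∣ ndeg G v} : Set V).ncard : ℝ) -
        Fintype.card V * p|} ≤
      4 * Real.exp (Fintype.card V * (l * δ + l ^ 2) - l * t / 2) := by
  set X : Finset V → SimpleGraph V → ℝ := fun B G => (#{v ∈ B | k ∣ ndeg G v} : ℝ) - #B * p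
  set n := Fintype.card V
  set E := Real.exp (n * (l * δ + l ^ 2))
  set M := (Nat.card (SimpleGraph V) : ℝ)
  have hsum : ∀ B : Finset V, (∀ c : ℕ,
      |(#{S ∈ Bᶜ.powerset | k ∣ c + #S} : ℝ) / 2 ^ #Bᶜ - p| ≤ δ) → ∀ l', |l'| = l →
      ∑ G : SimpleGraph V, Real.exp (l' * X B G) ≤ M * E := by
    intro B hB l' hl'
    refine (sum_exp_divisible_degrees_le B k hp0 hp1 (hl'.trans_le hl) hB).trans ?_
    rw [hl', ← sq_abs, hl']
    have : #B ≤ n := Finset.card_le_univ B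
    simp only [M, E]
    gcongr
  have hM : M = 2 ^ (Nat.card V).choose 2 := by
    simp only [M, card_simpleGraph_eq, Nat.cast_pow, Nat.cast_ofNat]
  have hMpos : 0 < M := by rw [hM]; positivity
  set bad := {G : SimpleGraph V | t < |(({v | k ∣ ndeg G v} : Set V).ncard : ℝ) - n * p|}
  have hpt : ∀ G ∈ bad, Real.exp (l * t / 2) ≤ Real.exp (l * X A G) + Real.exp (-l * X A G) +
      Real.exp (l * X Aᶜ G) + Real.exp (-l * X Aᶜ G) := by
    intro G hG
    have hsplit : (({v | k ∣ ndeg G v} : Set V).ncard : ℝ) - n * p = X A G + X Aᶜ G := by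
      have h1 : ({v | k ∣ ndeg G v} : Set V).ncard =
          #{v ∈ A | k ∣ ndeg G v} + #{v ∈ Aᶜ | k ∣ ndeg G v} := by
        rw [← Finset.card_union_of_disjoint
          (Finset.disjoint_filter_filter disjoint_compl_right), ← Finset.filter_union,
          Finset.union_compl, ← Set.ncard_coe_finset]
        simp
      have h2 : n = #A + #Aᶜ := (Finset.card_add_card_compl A).symm
      rw [h1, h2]
      push_cast
      ring
    have hG' : t < |X A G + X Aᶜ G| := by rw [← hsplit]; exact hG
    have hcase : t / 2 ≤ X A G ∨ t / 2 ≤ -X A G ∨ t / 2 ≤ X Aᶜ G ∨ t / 2 ≤ -X Aᶜ G := by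
      rcases lt_abs.1 hG' with h | h
      · by_cases h' : t / 2 ≤ X A G
        · exact Or.inl h'
        · exact Or.inr (Or.inr (Or.inl (by linarith)))
      · by_cases h' : t / 2 ≤ -X A G
        · exact Or.inr (Or.inl h')
        · exact Or.inr (Or.inr (Or.inr (by linarith)))
    have hexp : ∀ x : ℝ, t / 2 ≤ x → Real.exp (l * t / 2) ≤ Real.exp (l * x) := fun x hx => by
      rw [mul_div_assoc]; gcongr
    have e1 := Real.exp_pos (l * X A G)
    have e2 := Real.exp_pos (-l * X A G)
    have e3 := Real.exp_pos (l * X Aᶜ G)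
    have e4 := Real.exp_pos (-l * X Aᶜ G)
    rcases hcase with h | h | h | h <;> have := hexp _ h <;>
      simp only [mul_neg, neg_mul] at * <;> linarith
  have hcount : (Nat.card bad : ℝ) * Real.exp (l * t / 2) ≤ 4 * (M * E) := by
    calc (Nat.card bad : ℝ) * Real.exp (l * t / 2)
        = ∑ G ∈ bad.toFinset, Real.exp (l * t / 2) := by
          rw [Finset.sum_const, nsmul_eq_mul, Set.toFinset_card, Nat.card_eq_fintype_card]
      _ ≤ ∑ G ∈ bad.toFinset, (Real.exp (l * X A G) + Real.exp (-l * X A G) +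
            Real.exp (l * X Aᶜ G) + Real.exp (-l * X Aᶜ G)) :=
          Finset.sum_le_sum fun G hG => hpt G (Set.mem_toFinset.1 hG)
      _ ≤ ∑ G : SimpleGraph V, (Real.exp (l * X A G) + Real.exp (-l * X A G) +
            Real.exp (l * X Aᶜ G) + Real.exp (-l * X Aᶜ G)) :=
          Finset.sum_le_sum_of_subset_of_nonneg (Finset.subset_univ _)
            fun G _ _ => by positivity
      _ ≤ M * E + M * E + M * E + M * E := by
          simp only [Finset.sum_add_distrib]
          have hpos : |l| = l := abs_of_nonneg hl0
          have hneg : |-l| = l := by rw [abs_neg, hpos]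
          gcongr
          · exact hsum A hAc l hpos
          · exact hsum A hAc (-l) hneg
          · exact hsum Aᶜ (by rwa [compl_compl]) l hpos
          · exact hsum Aᶜ (by rwa [compl_compl]) (-l) hneg
      _ = 4 * (M * E) := by ring
  rw [gprob, ← hM, Real.exp_sub, div_le_iff₀ hMpos, ← mul_div_assoc, div_mul_eq_mul_div,
    le_div_iff₀ (Real.exp_pos _)]
  linarith

/-- The number of vertices of `G_n` with degree divisible by `k` lies within `√n · ln n`
of `n/k` with probability `1 − o(1/n³)`. -/
theorem number_of_divisible_degrees_concentrated
    (k : ℕ) (hodd : Odd k) (hk : 11 < k) (hdvd : ¬ (11 ∣ k)) :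
    Tendsto (fun n : ℕ => (n : ℝ) ^ 3 *
      gprob {G : SimpleGraph (Fin n) |
        |((divisorSet k G).ncard : ℝ) - (n : ℝ) / k| > Real.sqrt n * Real.log n})
      atTop (nhds 0) := by
  obtain ⟨r, hr0, hr1, hr⟩ := exists_abs_divisible_card_sub_le k (by omega)
  obtain ⟨C, hC⟩ := (tendsto_self_mul_const_pow_of_lt_one hr0 hr1).bddAbove_range
  have hC' : ∀ m : ℕ, m * r ^ m ≤ C := fun m => hC ⟨m, rfl⟩
  set D := 4 * Real.exp (8 * (2 * C + 1) + 64)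
  have hlim : Tendsto (fun n : ℕ => D / (n : ℝ)) atTop (nhds 0) :=
    tendsto_const_div_atTop_nhds_zero_nat D
  refine squeeze_zero' (Eventually.of_forall fun n => ?_) ?_ hlim
  · unfold gprob; positivity
  filter_upwards [eventually_ge_atTop 64] with n hn
  have hnpos : (0 : ℝ) < n := by positivity
  obtain ⟨A, -, hA⟩ := Finset.exists_subset_card_eq
    (show n / 2 ≤ #(Finset.univ : Finset (Fin n)) by simp; omega)
  have hAc : n / 2 ≤ #Aᶜ := by
    rw [Finset.card_compl, Fintype.card_fin, hA]; omega
  set s := Real.sqrt n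
  have hs2 : s ^ 2 = n := Real.sq_sqrt hnpos.le
  have hs8 : 8 ≤ s := Real.le_sqrt_of_sq_le (by norm_num; exact_mod_cast hn)
  have hspos : 0 < s := by linarith
  set δ := r ^ (n / 2)
  have hδ0 : 0 ≤ δ := by positivity
  have hδ1 : δ ≤ 1 := pow_le_one₀ hr0 hr1.le
  have hnδ : n * δ ≤ 2 * C + 1 := by
    have h1 : (n : ℝ) ≤ 2 * (n / 2 : ℕ) + 1 := by norm_cast; omega
    have h2 := hC' (n / 2)
    calc n * δ ≤ (2 * (n / 2 : ℕ) + 1) * δ := by gcongr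
      _ = 2 * ((n / 2 : ℕ) * δ) + δ := by ring
      _ ≤ _ := by linarith
  have key := gprob_divisible_degrees_deviation_le A k (p := 1 / k) (δ := δ) (l := 8 / s)
    (t := s * Real.log n) (by positivity)
    ((div_le_one₀ (by positivity)).2 (by norm_cast; omega)) (by positivity)
    ((div_le_one₀ hspos).2 hs8) hδ0
    (fun c => (hr A c).trans (by rw [hA]))
    (fun c => le_trans (le_of_eq (by congr!))
      ((hr Aᶜ c).trans (pow_le_pow_of_le_one hr0 hr1.le hAc)))
  rw [Fintype.card_fin, mul_one_div] at key
  have hexp : n * (8 / s * δ + (8 / s) ^ 2) - 8 / s * (s * Real.log n) / 2 ≤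
      8 * (2 * C + 1) + 64 - 4 * Real.log n := by
    have h1 : n * (8 / s) ^ 2 = 64 := by
      rw [div_pow, hs2]; field_simp; norm_num
    have h2 : 8 / s * (s * Real.log n) / 2 = 4 * Real.log n := by field_simp; ring
    have h3 : n * (8 / s * δ) ≤ 8 * (2 * C + 1) := by
      calc n * (8 / s * δ) = 8 / s * (n * δ) := by ring
        _ ≤ 8 * (n * δ) := by
          gcongr
          exact div_le_self (by norm_num) (by linarith)
        _ ≤ _ := by gcongr
    rw [mul_add, h1, h2]
    linarith
  have hlog : Real.exp (4 * Real.log n) = (n : ℝ) ^ 4 := by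
    rw [mul_comm, Real.exp_mul, Real.exp_log hnpos]; norm_cast
  calc _ ≤ (n : ℝ) ^ 3 * (4 * Real.exp (8 * (2 * C + 1) + 64 - 4 * Real.log n)) := by
        gcongr
        exact key.trans (by gcongr)
    _ = D / n := by
        rw [Real.exp_sub, hlog]
        simp only [D]
        field_simp
end

section
/- With high probability, the number of vertices i of G_n whose degree ξ_i satisfies |ξ_i − n/2| > (1/2)·√(n·ln n·(1−ζ₁)) is at most 4·√n·(ln n)^{1/4}. -/
open Filter

/-- `N_y`: the number of vertices of degree `y` in a graph on `Fin n`. -/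
noncomputable def Ncount {n : ℕ} (G : SimpleGraph (Fin n)) (y : ℤ) : ℕ :=
  Set.ncard {v : Fin n | (ndeg G v : ℤ) = y}

/-- `ζ₁ = (ln(2π) + (3/2)·ln ln n) / ln n`. -/
noncomputable def zeta1 (n : ℕ) : ℝ :=
  (Real.log (2 * Real.pi) + (3 / 2) * Real.log (Real.log n)) / Real.log n

/-- `ζ₂ = (ln(2π) + (5/2)·ln ln n) / ln n`. -/
noncomputable def zeta2 (n : ℕ) : ℝ :=
  (Real.log (2 * Real.pi) + (5 / 2) * Real.log (Real.log n)) / Real.log n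

open Finset in
/-- There are `2 ^ (|V| choose 2)` simple graphs on a finite vertex set `V`. -/
lemma card_simpleGraph_eq_two_pow (V : Type*) [Fintype V] [DecidableEq V] :
    Fintype.card (SimpleGraph V) = 2 ^ (Fintype.card V).choose 2 := by
  classical
  rw [← SimpleGraph.card_edgeFinset_top_eq_card_choose_two (V := V), ← card_powerset,
    ← card_univ]
  refine card_bij' (fun G _ => G.edgeFinset)
    (fun s _ => SimpleGraph.fromEdgeSet (s : Set (Sym2 V))) ?_ ?_ ?_ ?_
  · intro G _
    rw [mem_powerset]
    exact SimpleGraph.edgeFinset_mono le_top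
  · simp
  · intro G _
    simp
  · intro s hs
    rw [mem_powerset] at hs
    ext e
    simp only [SimpleGraph.mem_edgeFinset, SimpleGraph.edgeSet_fromEdgeSet, Set.mem_sdiff,
      mem_coe, and_iff_left_iff_imp]
    intro he
    have := hs he
    rw [SimpleGraph.mem_edgeFinset] at this
    simpa using SimpleGraph.not_isDiag_of_mem_edgeSet _ this

/-- The neighbours of `i` in `G` other than `j`. -/
noncomputable def otherNeighbors {V : Type*} [Fintype V] (G : SimpleGraph V) (i j : V) :
    Finset V := by
  classical exact (({i, j} : Finset V)ᶜ).filter (fun w => G.Adj i w)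

lemma mem_otherNeighbors {V : Type*} [Fintype V] {G : SimpleGraph V} {i j w : V} :
    w ∈ otherNeighbors G i j ↔ w ≠ i ∧ w ≠ j ∧ G.Adj i w := by
  classical
  simp [otherNeighbors, and_assoc]

open Finset Classical in
/-- Outside `{i, j}`, all pairs of neighbourhoods of `i` and `j` are equally frequent. -/
lemma card_filter_otherNeighbors_eq {V : Type*} [Fintype V] [DecidableEq V] {i j : V}
    (hij : i ≠ j) {A B : Finset V} (hA : A ⊆ {i, j}ᶜ) (hB : B ⊆ {i, j}ᶜ) :
    #{G : SimpleGraph V | (otherNeighbors G i j, otherNeighbors G j i) = (A, B)} =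
      #{G : SimpleGraph V | (otherNeighbors G i j, otherNeighbors G j i) = (∅, ∅)} := by
  let H : SimpleGraph V := SimpleGraph.fromRel (fun u v => (u = i ∧ v ∈ A) ∨ (u = j ∧ v ∈ B))
  have hA' : ∀ w ∈ A, w ≠ i ∧ w ≠ j := fun w hw => by simpa using hA hw
  have hB' : ∀ w ∈ B, w ≠ i ∧ w ≠ j := fun w hw => by simpa using hB hw
  have hHi : ∀ w, w ≠ i → w ≠ j → (H.Adj i w ↔ w ∈ A) := by
    intro w hi hj
    simp only [H, SimpleGraph.fromRel_adj]
    grind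
  have hHj : ∀ w, w ≠ i → w ≠ j → (H.Adj j w ↔ w ∈ B) := by
    intro w hi hj
    simp only [H, SimpleGraph.fromRel_adj]
    grind
  have hadj : ∀ (G : SimpleGraph V) u v,
      (symmDiff G H).Adj u v ↔ (G.Adj u v ∧ ¬ H.Adj u v) ∨ (H.Adj u v ∧ ¬ G.Adj u v) := by
    intro G u v
    simp [symmDiff]
  refine card_bij' (fun G _ => symmDiff G H) (fun G _ => symmDiff G H) ?_ ?_ ?_ ?_
  · intro G hG
    simp only [mem_filter, mem_univ, true_and, Prod.mk.injEq, Finset.ext_iff,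
      mem_otherNeighbors, hadj] at hG ⊢
    grind
  · intro G hG
    simp only [mem_filter, mem_univ, true_and, Prod.mk.injEq, Finset.ext_iff,
      mem_otherNeighbors, hadj] at hG ⊢
    grind
  · intro G _
    exact symmDiff_symmDiff_cancel_right _ _
  · intro G _
    exact symmDiff_symmDiff_cancel_right _ _

open Finset Classical in
lemma card_filter_otherNeighbors_mem {V : Type*} [Fintype V] [DecidableEq V] {i j : V}
    (hij : i ≠ j) (S : Finset (Finset V × Finset V))
    (hS : S ⊆ (({i, j} : Finset V)ᶜ).powerset ×ˢ (({i, j} : Finset V)ᶜ).powerset) :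
    #{G : SimpleGraph V | (otherNeighbors G i j, otherNeighbors G j i) ∈ S} =
      #S * #{G : SimpleGraph V | (otherNeighbors G i j, otherNeighbors G j i) = (∅, ∅)} := by
  rw [card_eq_sum_card_fiberwise
    (f := fun G : SimpleGraph V => (otherNeighbors G i j, otherNeighbors G j i)) (t := S)
    (fun G hG => by simpa using hG), ← smul_eq_mul, ← sum_const]
  refine sum_congr rfl fun p hp => ?_
  obtain ⟨A, B⟩ := p
  have h := hS hp
  rw [mem_product, mem_powerset, mem_powerset] at h
  rw [← card_filter_otherNeighbors_eq hij h.1 h.2, filter_filter]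
  congr 1
  ext G
  simp only [mem_filter, mem_univ, true_and, and_iff_right_iff_imp]
  intro h
  rwa [h]

open Finset Classical in
/-- The probability that a `Bin(N, 1/2)` random variable satisfies `P`. -/
noncomputable def binProb (N : ℕ) (P : ℕ → Prop) : ℝ :=
  (∑ k ∈ range (N + 1) with P k, (N.choose k : ℝ)) / 2 ^ N

open Finset Classical in
lemma card_powerset_filter_card {V : Type*} (W : Finset V) (P : ℕ → Prop) :
    (#{A ∈ W.powerset | P #A} : ℝ) = 2 ^ #W * binProb #W P := by
  rw [binProb, mul_div_cancel₀ _ (by positivity)]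
  rw [card_eq_sum_card_fiberwise (f := fun A => #A) (t := {k ∈ range (#W + 1) | P k})]
  · push_cast
    refine sum_congr rfl fun k hk => ?_
    rw [← card_powersetCard]
    congr 2
    ext A
    simp only [mem_filter, mem_range, mem_powerset, mem_powersetCard] at hk ⊢
    grind
  · intro A hA
    simp only [coe_filter, mem_powerset, Set.mem_ofPred_eq, mem_range] at hA ⊢
    exact ⟨Nat.lt_succ_of_le (card_le_card hA.1), hA.2⟩

open Finset Classical in
/-- The numbers of neighbours of `i` and `j` outside `{i, j}` are independent binomials. -/
lemma card_filter_card_otherNeighbors {V : Type*} [Fintype V] [DecidableEq V] {i j : V}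
    (hij : i ≠ j) (P Q : ℕ → Prop) :
    (#{G : SimpleGraph V | P #(otherNeighbors G i j) ∧ Q #(otherNeighbors G j i)} : ℝ) =
      Fintype.card (SimpleGraph V) * binProb (Fintype.card V - 2) P *
        binProb (Fintype.card V - 2) Q := by
  set W : Finset V := {i, j}ᶜ with hW
  have hWcard : #W = Fintype.card V - 2 := by
    rw [hW, card_compl, card_pair hij]
  have hmem : ∀ G : SimpleGraph V, otherNeighbors G i j ∈ W.powerset ∧
      otherNeighbors G j i ∈ W.powerset := by
    intro G
    simp only [mem_powerset, subset_iff, mem_otherNeighbors, hW, mem_compl, mem_insert,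
      mem_singleton]
    grind
  have hall := card_filter_otherNeighbors_mem hij (W.powerset ×ˢ W.powerset) subset_rfl
  have hPQ := card_filter_otherNeighbors_mem hij
    ({A ∈ W.powerset | P #A} ×ˢ {A ∈ W.powerset | Q #A})
    (product_subset_product (filter_subset _ _) (filter_subset _ _))
  simp only [mem_product, hmem, and_self, filter_true, card_univ, mem_filter, true_and,
    card_product, card_powerset] at hall hPQ
  rw [hPQ, hall, ← hWcard]
  push_cast
  rw [card_powerset_filter_card, card_powerset_filter_card]
  ring

open Finset Classical in
lemma binProb_nonneg (N : ℕ) (P : ℕ → Prop) : 0 ≤ binProb N P := by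
  unfold binProb
  positivity

open Finset Classical in
lemma binProb_mono {N : ℕ} {P Q : ℕ → Prop} (h : ∀ k, P k → Q k) : binProb N P ≤ binProb N Q := by
  unfold binProb
  gcongr with k hk
  exact h k

open Finset Classical in
lemma binProb_or_le (N : ℕ) (P Q : ℕ → Prop) :
    binProb N (fun k => P k ∨ Q k) ≤ binProb N P + binProb N Q := by
  unfold binProb
  rw [← add_div, ← sum_union_inter]
  gcongr
  refine le_trans (sum_le_sum_of_subset_of_nonneg (f := fun k => (N.choose k : ℝ))
    (t := {k ∈ range (N + 1) | P k} ∪ {k ∈ range (N + 1) | Q k}) (fun k hk => ?_)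
    fun _ _ _ => by positivity)
    (le_add_of_nonneg_right (sum_nonneg fun _ _ => Nat.cast_nonneg _))
  simp only [mem_filter, mem_union] at hk ⊢
  tauto

open Finset Classical in
lemma binProb_true (N : ℕ) : binProb N (fun _ => True) = 1 := by
  unfold binProb
  rw [filter_true, ← Nat.cast_sum, Nat.sum_range_choose]
  simp

open Finset Classical in
lemma binProb_abs_le (N : ℕ) (R : ℝ → Prop) :
    binProb N (fun k => R |(k : ℝ) - N / 2|) ≤
      2 * binProb N (fun k => (N : ℝ) / 2 ≤ k ∧ R ((k : ℝ) - N / 2)) := by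
  have hrefl : binProb N (fun k => (k : ℝ) ≤ N / 2 ∧ R ((N : ℝ) / 2 - k)) =
      binProb N (fun k => (N : ℝ) / 2 ≤ k ∧ R ((k : ℝ) - N / 2)) := by
    unfold binProb
    congr 1
    refine sum_bij' (fun k _ => N - k) (fun k _ => N - k) ?_ ?_ ?_ ?_ ?_
    · intro k hk
      simp only [mem_filter, mem_range] at hk ⊢
      rw [Nat.cast_sub (by omega)]
      refine ⟨by omega, by linarith [hk.2.1], ?_⟩
      convert hk.2.2 using 1
      ring
    · intro k hk
      simp only [mem_filter, mem_range] at hk ⊢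
      rw [Nat.cast_sub (by omega)]
      refine ⟨by omega, by linarith [hk.2.1], ?_⟩
      convert hk.2.2 using 1
      ring
    · intro k hk
      simp only [mem_filter, mem_range] at hk
      omega
    · intro k hk
      simp only [mem_filter, mem_range] at hk
      omega
    · intro k hk
      simp only [mem_filter, mem_range] at hk
      rw [Nat.choose_symm (by omega)]
  rw [two_mul]
  nth_rewrite 2 [← hrefl]
  refine le_trans (binProb_mono fun k hk => ?_) (binProb_or_le N _ _)
  rcases le_total ((N : ℝ) / 2) k with h | h
  · left
    rw [abs_of_nonneg (by linarith)] at hk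
    exact ⟨h, hk⟩
  · right
    rw [abs_of_nonpos (by linarith), neg_sub] at hk
    exact ⟨h, hk⟩

lemma centralBinom_sq_mul_le (m : ℕ) : m.centralBinom ^ 2 * (2 * m + 1) ≤ 16 ^ m := by
  induction m with
  | zero => simp
  | succ m ih =>
    have h := Nat.succ_mul_centralBinom_succ m
    refine le_of_mul_le_mul_left ?_ (show 0 < (m + 1) ^ 2 by positivity)
    have hm : (2 * m + 1) * (2 * m + 3) ≤ 4 * (m + 1) ^ 2 := by nlinarith
    calc (m + 1) ^ 2 * ((m + 1).centralBinom ^ 2 * (2 * (m + 1) + 1))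
        = ((m + 1) * (m + 1).centralBinom) ^ 2 * (2 * m + 3) := by ring
      _ = 4 * ((2 * m + 1) * (2 * m + 3)) * (m.centralBinom ^ 2 * (2 * m + 1)) := by
        rw [h]; ring
      _ ≤ 4 * (4 * (m + 1) ^ 2) * 16 ^ m := by gcongr 4 * ?_ * ?_
      _ = (m + 1) ^ 2 * 16 ^ (m + 1) := by ring

lemma choose_sq_mul_le (N k : ℕ) : (N.choose k) ^ 2 * (N + 1) ≤ 4 ^ N := by
  rcases Nat.even_or_odd' N with ⟨m, rfl | rfl⟩
  · calc _ ≤ m.centralBinom ^ 2 * (2 * m + 1) := by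
          gcongr
          exact Nat.choose_le_centralBinom k m
      _ ≤ 16 ^ m := centralBinom_sq_mul_le m
      _ = _ := by rw [pow_mul]; norm_num
  · have h1 : (2 * m + 1).choose k ≤ (2 * m + 1).choose m := by
      convert Nat.choose_le_middle k (2 * m + 1) using 2
      omega
    have h2 : (m + 1).centralBinom = 2 * (2 * m + 1).choose m := by
      rw [Nat.centralBinom_eq_two_mul_choose, show 2 * (m + 1) = (2 * m + 1) + 1 by ring,
        Nat.choose_succ_succ, Nat.choose_symm_half]
      ring
    have h3 := centralBinom_sq_mul_le (m + 1)
    rw [h2, pow_succ 16] at h3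
    have h4 : 4 ^ (2 * m + 1) = 4 * 16 ^ m := by rw [pow_succ, pow_mul]; norm_num; ring
    rw [h4]
    calc _ ≤ (2 * m + 1).choose m ^ 2 * (2 * m + 1 + 1) := by gcongr
      _ ≤ (2 * m + 1).choose m ^ 2 * (2 * (m + 1) + 1) := by gcongr; omega
      _ ≤ _ := by nlinarith

lemma choose_le_two_pow_div_sqrt (N k : ℕ) : (N.choose k : ℝ) ≤ 2 ^ N / √(N + 1) := by
  rw [le_div_iff₀ (by positivity)]
  refine abs_le_of_sq_le_sq' ?_ (by positivity) |>.2
  rw [mul_pow, Real.sq_sqrt (by positivity), ← pow_mul, mul_comm N 2, pow_mul]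
  have := choose_sq_mul_le N k
  norm_num
  exact_mod_cast this

lemma cast_choose_succ_mul (N k : ℕ) :
    (N.choose (k + 1) : ℝ) * (k + 1) = N.choose k * (N - k) := by
  rcases le_or_gt k N with hkN | hkN
  · have := Nat.choose_succ_right_eq N k
    rw [← Nat.cast_sub hkN]
    exact_mod_cast this
  · simp [Nat.choose_eq_zero_of_lt hkN, Nat.choose_eq_zero_of_lt (show N < k + 1 by omega)]

/-- A Gaussian upper bound for the upper half of the binomial coefficients. -/
lemma choose_le_gaussian {N k : ℕ} (hk : N ≤ 2 * k) :
    (N.choose k : ℝ) ≤ 2 ^ N / √(N + 1) *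
      Real.exp (1 / (2 * (N + 1)) - 2 * ((k : ℝ) - N / 2) ^ 2 / (N + 1)) := by
  have hN : (0 : ℝ) < N + 1 := by positivity
  have hk' : (N + 1) / 2 ≤ k := by omega
  induction k, hk' using Nat.le_induction with
  | base =>
    refine (choose_le_two_pow_div_sqrt N _).trans
      (le_mul_of_one_le_right (by positivity) (Real.one_le_exp ?_))
    have h1 : (N : ℝ) ≤ 2 * ((N + 1) / 2 : ℕ) := by exact_mod_cast hk
    have h2 : (2 : ℝ) * ((N + 1) / 2 : ℕ) ≤ N + 1 := by
      exact_mod_cast Nat.mul_div_le (N + 1) 2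
    rw [show (1 : ℝ) / (2 * (N + 1)) = (1 / 2) / (N + 1) by field_simp, ← sub_div]
    apply div_nonneg _ hN.le
    nlinarith
  | succ k hk1 ih =>
    have h := ih (by omega)
    have hrec := cast_choose_succ_mul N k
    set x : ℝ := (2 * k + 1 - N) / (N + 1) with hx
    have hx0 : 0 ≤ x := by
      have : (N : ℝ) ≤ 2 * k + 1 := by exact_mod_cast (by omega : N ≤ 2 * k + 1)
      exact div_nonneg (by linarith) hN.le
    have hratio : (N : ℝ) - k ≤ (k + 1) * Real.exp (-(2 * x)) := by
      rcases le_or_gt 1 x with hx1 | hx1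
      · have : (N : ℝ) - k ≤ 0 := by
          rw [hx, le_div_iff₀ hN] at hx1
          linarith
        exact this.trans (by positivity)
      · have hlog : 2 * x ≤ Real.log (1 + x) - Real.log (1 - x) := by
          have hs := Real.hasSum_log_sub_log_of_abs_lt_one (x := x) (by rwa [abs_of_nonneg hx0])
          have := hs.summable.le_tsum 0 (fun j _ => by positivity)
          rw [hs.tsum_eq] at this
          simpa using this
        have hexp : 1 - x ≤ (1 + x) * Real.exp (-(2 * x)) := by
          rw [← Real.log_div (by linarith) (by linarith),
            Real.le_log_iff_exp_le (div_pos (by linarith) (by linarith)),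
            le_div_iff₀ (by linarith)] at hlog
          rw [Real.exp_neg, ← div_eq_mul_inv, le_div_iff₀ (Real.exp_pos _)]
          linarith
        have e1 : (N : ℝ) - k = (N + 1) / 2 * (1 - x) := by rw [hx]; field_simp; ring
        have e2 : (k : ℝ) + 1 = (N + 1) / 2 * (1 + x) := by rw [hx]; field_simp; ring
        rw [e1, e2, mul_assoc]
        gcongr
    have hle : (N.choose (k + 1) : ℝ) ≤ N.choose k * Real.exp (-(2 * x)) := by
      refine le_of_mul_le_mul_right ?_ (show (0 : ℝ) < k + 1 by positivity)
      rw [hrec, mul_assoc, mul_comm (Real.exp _)]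
      gcongr
    refine hle.trans ((mul_le_mul_of_nonneg_right h (Real.exp_nonneg _)).trans_eq ?_)
    rw [mul_assoc, ← Real.exp_add, hx]
    congr 2
    push_cast
    field_simp
    ring

open Finset in
lemma sum_Ico_choose_mul (N k m : ℕ) (hkm : k ≤ m) :
    ∑ j ∈ Ico k m, (2 * (j : ℝ) - N) * N.choose j = k * N.choose k - m * N.choose m := by
  induction m, hkm using Nat.le_induction with
  | base => simp
  | succ m hkm ih =>
    rw [sum_Ico_succ_top hkm, ih]
    have hrec := cast_choose_succ_mul N m
    push_cast
    linear_combination hrec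

open Finset Classical in
lemma binProb_upper_tail_le (N : ℕ) {u : ℝ} (hu : 0 < u) :
    binProb N (fun k => (N : ℝ) / 2 ≤ k ∧ u < (k : ℝ) - N / 2) ≤
      1 / √(N + 1) * Real.exp (1 / (2 * (N + 1)) - 2 * u ^ 2 / (N + 1)) *
        (1 / 2 + N / (4 * u)) := by
  set m : ℕ := ⌊(N : ℝ) / 2 + u⌋₊ + 1 with hm
  have hmu : (N : ℝ) / 2 + u < m := by
    rw [hm]; exact_mod_cast Nat.lt_floor_add_one ((N : ℝ) / 2 + u)
  have hcongr : binProb N (fun k => (N : ℝ) / 2 ≤ k ∧ u < (k : ℝ) - N / 2) ≤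
      (∑ k ∈ Ico m (max m (N + 1)), (N.choose k : ℝ)) / 2 ^ N := by
    unfold binProb
    gcongr
    intro k hk
    simp only [mem_filter, mem_range, mem_Ico, lt_max_iff] at hk ⊢
    refine ⟨?_, Or.inr hk.1⟩
    rw [hm, Nat.succ_le_iff, Nat.floor_lt (by positivity)]
    linarith [hk.2.2]
  refine hcongr.trans ?_
  have hpos : (0 : ℝ) < 2 * m - N := by linarith
  have htail : (∑ k ∈ Ico m (max m (N + 1)), (N.choose k : ℝ)) * (2 * m - N) ≤
      m * N.choose m := by
    calc _ ≤ ∑ j ∈ Ico m (max m (N + 1)), (2 * (j : ℝ) - N) * N.choose j := by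
          rw [sum_mul]
          refine sum_le_sum fun j hj => ?_
          rw [mul_comm]
          have : (m : ℝ) ≤ j := by exact_mod_cast (mem_Ico.1 hj).1
          gcongr
      _ ≤ _ := by
          rw [sum_Ico_choose_mul N m _ (le_max_left _ _)]
          linarith [show (0 : ℝ) ≤ ((max m (N + 1) : ℕ) : ℝ) * N.choose (max m (N + 1)) by
            positivity]
  rw [← le_div_iff₀ hpos] at htail
  have hNm : N ≤ 2 * m := by
    have : (N : ℝ) ≤ 2 * m := by linarith
    exact_mod_cast this
  rw [div_le_iff₀ (by positivity)]
  refine htail.trans ?_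
  have hfrac : (m : ℝ) / (2 * m - N) ≤ 1 / 2 + N / (4 * u) := by
    have : (m : ℝ) / (2 * m - N) = 1 / 2 + N / (2 * (2 * m - N)) := by
      rw [div_add_div _ _ two_ne_zero (by positivity), div_eq_div_iff hpos.ne' (by positivity)]
      ring
    rw [this]
    refine add_le_add le_rfl (div_le_div_of_nonneg_left (by positivity) (by positivity) ?_)
    linarith
  calc _ = (N.choose m : ℝ) * (m / (2 * m - N)) := by ring
    _ ≤ (2 ^ N / √(N + 1) * Real.exp (1 / (2 * (N + 1)) - 2 * u ^ 2 / (N + 1))) *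
        (1 / 2 + N / (4 * u)) := by
      gcongr
      refine (choose_le_gaussian hNm).trans ?_
      gcongr
      linarith
    _ = _ := by ring

lemma binProb_tail_le (N : ℕ) {u : ℝ} (hu : 0 < u) :
    binProb N (fun k => u < |(k : ℝ) - N / 2|) ≤
      2 * (1 / √(N + 1) * Real.exp (1 / (2 * (N + 1)) - 2 * u ^ 2 / (N + 1)) *
        (1 / 2 + N / (4 * u))) :=
  (binProb_abs_le N (fun x => u < x)).trans (by gcongr; exact binProb_upper_tail_le N hu)

open Finset Classical in
lemma binProb_tail_sub_le (N : ℕ) {u : ℝ} (hu : 0 < u) :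
    binProb N (fun k => u < |(k : ℝ) - N / 2|) ≤
      binProb N (fun k => u + 2 < |(k : ℝ) - N / 2|) + 4 / √(N + 1) := by
  have hwin : binProb N (fun k => u < |(k : ℝ) - N / 2| ∧ |(k : ℝ) - N / 2| ≤ u + 2) ≤
      4 / √(N + 1) := by
    refine (binProb_abs_le N (fun x => u < x ∧ x ≤ u + 2)).trans ?_
    set m : ℕ := ⌊(N : ℝ) / 2 + u⌋₊ with hm
    have hsum : binProb N (fun k => (N : ℝ) / 2 ≤ k ∧ u < (k : ℝ) - N / 2 ∧
        (k : ℝ) - N / 2 ≤ u + 2) ≤ 2 / √(N + 1) := by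
      unfold binProb
      rw [div_le_iff₀ (by positivity)]
      refine (sum_le_sum_of_subset_of_nonneg (f := fun k => (N.choose k : ℝ)) (t := Ioc m (m + 2))
        (fun k hk => ?_) fun _ _ _ => by positivity).trans ?_
      · simp only [mem_filter, mem_range, mem_Ioc] at hk ⊢
        constructor
        · rw [hm, Nat.floor_lt (by positivity)]
          linarith [hk.2.2.1]
        · rw [hm, ← Nat.floor_add_ofNat (by positivity), Nat.le_floor_iff (by positivity)]
          linarith [hk.2.2.2]
      refine (sum_le_card_nsmul _ _ _ fun k _ => choose_le_two_pow_div_sqrt N k).trans_eq ?_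
      rw [Nat.card_Ioc, Nat.add_sub_cancel_left, nsmul_eq_mul]
      push_cast
      ring
    calc _ ≤ 2 * (2 / √((N : ℝ) + 1)) := by gcongr
      _ = _ := by ring
  refine (le_trans (binProb_mono fun k hk => ?_) (binProb_or_le N _ _)).trans (by gcongr)
  by_cases h : u + 2 < |(k : ℝ) - N / 2|
  · exact Or.inl h
  · exact Or.inr ⟨hk, not_lt.1 h⟩

open Finset Classical in
/-- A second moment bound for the number of events that occur at a uniformly random point, when
the events have probability between `p` and `q` and distinct events occur jointly with
probability at most `q ^ 2`. -/
lemma card_filter_lt_mul_sq_le {Ω ι : Type*} [Fintype Ω] [Fintype ι] (E : Ω → ι → Prop)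
    {p q M : ℝ} (hM : 0 ≤ M) (hq : 0 ≤ q)
    (hlow : ∀ i, Fintype.card Ω * p ≤ #{ω | E ω i})
    (hupp : ∀ i, (#{ω | E ω i} : ℝ) ≤ Fintype.card Ω * q)
    (hpair : ∀ i j, i ≠ j → (#{ω | E ω i ∧ E ω j} : ℝ) ≤ Fintype.card Ω * q ^ 2) :
    (#{ω | Fintype.card ι * q + M < #{i | E ω i}} : ℝ) * M ^ 2 ≤
      Fintype.card Ω *
        (Fintype.card ι * q + 2 * (Fintype.card ι) ^ 2 * q * (q - p)) := by
  set T : ℝ := (Fintype.card Ω : ℝ)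
  set n : ℝ := (Fintype.card ι : ℝ)
  have hT : 0 ≤ T := Nat.cast_nonneg _
  have hX : ∀ ω, (#{i | E ω i} : ℝ) = ∑ i, if E ω i then (1 : ℝ) else 0 := by
    intro ω
    rw [sum_boole]
  have hfirst : T * (n * p) ≤ ∑ ω, (#{i | E ω i} : ℝ) := by
    simp_rw [hX]
    rw [sum_comm]
    simp_rw [sum_boole]
    calc T * (n * p) = ∑ _i : ι, T * p := by
          rw [sum_const, card_univ, nsmul_eq_mul]; ring
      _ ≤ _ := sum_le_sum fun i _ => hlow i
  have hsecond : ∑ ω, (#{i | E ω i} : ℝ) ^ 2 ≤ T * (n * q + n ^ 2 * q ^ 2) := by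
    have hsq : ∀ ω, (#{i | E ω i} : ℝ) ^ 2 =
        ∑ i, ∑ j, if E ω i ∧ E ω j then (1 : ℝ) else 0 := by
      intro ω
      rw [hX, sq, sum_mul_sum]
      refine sum_congr rfl fun i _ => sum_congr rfl fun j _ => ?_
      split_ifs <;> simp_all
    simp_rw [hsq]
    rw [sum_comm]
    calc ∑ i, ∑ ω, ∑ j, (if E ω i ∧ E ω j then (1 : ℝ) else 0)
        = ∑ i : ι, ∑ j : ι, (#{ω | E ω i ∧ E ω j} : ℝ) := by
          refine sum_congr rfl fun i _ => ?_
          rw [sum_comm]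
          simp_rw [sum_boole]
      _ ≤ ∑ i : ι, ∑ j : ι, ((if i = j then T * q else 0) + T * q ^ 2) := by
          refine sum_le_sum fun i _ => sum_le_sum fun j _ => ?_
          split_ifs with hij
          · subst hij
            simp only [and_self]
            nlinarith [hupp i, mul_nonneg hT (sq_nonneg q)]
          · rw [zero_add]
            exact hpair i j hij
      _ = T * (n * q + n ^ 2 * q ^ 2) := by
          simp only [sum_add_distrib, sum_ite_eq, mem_univ, if_true, sum_const, card_univ,
            nsmul_eq_mul]
          ring
  calc (#{ω | n * q + M < #{i | E ω i}} : ℝ) * M ^ 2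
      = ∑ ω with n * q + M < #{i | E ω i}, M ^ 2 := by rw [sum_const, nsmul_eq_mul]
    _ ≤ ∑ ω with n * q + M < #{i | E ω i}, ((#{i | E ω i} : ℝ) - n * q) ^ 2 := by
        refine sum_le_sum fun ω hω => ?_
        rw [mem_filter] at hω
        exact pow_le_pow_left₀ hM (by linarith [hω.2]) 2
    _ ≤ ∑ ω, ((#{i | E ω i} : ℝ) - n * q) ^ 2 :=
        sum_le_sum_of_subset_of_nonneg (subset_univ _) fun _ _ _ => sq_nonneg _
    _ = ∑ ω, (#{i | E ω i} : ℝ) ^ 2 - 2 * (n * q) * ∑ ω, (#{i | E ω i} : ℝ) +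
          T * (n * q) ^ 2 := by
        simp_rw [sub_sq, sum_add_distrib, sum_sub_distrib]
        rw [sum_const, card_univ, nsmul_eq_mul, mul_sum]
        congr 2
        exact sum_congr rfl fun _ _ => by ring
    _ ≤ T * (n * q + n ^ 2 * q ^ 2) - 2 * (n * q) * (T * (n * p)) + T * (n * q) ^ 2 := by
        gcongr
    _ = _ := by ring

open Finset Classical in
lemma ndeg_eq_card_otherNeighbors_add {V : Type*} [Fintype V] (G : SimpleGraph V) (i j : V) :
    ndeg G i = #(otherNeighbors G i j) + if G.Adj i j then 1 else 0 := by
  rw [ndeg, Nat.card_eq_fintype_card, SimpleGraph.card_neighborSet_eq_degree,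
    ← SimpleGraph.card_neighborFinset_eq_degree]
  have ho : otherNeighbors G i j = (G.neighborFinset i).erase j := by
    ext w
    rw [mem_otherNeighbors, mem_erase, SimpleGraph.mem_neighborFinset]
    have := G.ne_of_adj (a := i) (b := w)
    tauto
  rw [ho]
  split_ifs with h
  · rw [card_erase_add_one (by simpa using h)]
  · rw [erase_eq_of_notMem (by simpa using h), add_zero]

open Finset Classical in
lemma abs_ndeg_sub_sub_le {n : ℕ} (hn : 2 ≤ n) (G : SimpleGraph (Fin n)) (i j : Fin n) :
    |((ndeg G i : ℝ) - n / 2) - (#(otherNeighbors G i j) - ((n - 2 : ℕ) : ℝ) / 2)| ≤ 1 := by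
  rw [ndeg_eq_card_otherNeighbors_add G i j, Nat.cast_sub hn, abs_le]
  push_cast
  split_ifs <;> constructor <;> linarith

open Finset Classical in
/-- A second moment bound for the number of vertices of degree far from `n / 2`. -/
lemma one_sub_gprob_le {n : ℕ} (hn : 2 ≤ n) {t M q p : ℝ} (hM : 0 < M)
    (hqdef : q = binProb (n - 2) (fun k => t - 1 < |(k : ℝ) - (n - 2 : ℕ) / 2|))
    (hpdef : p = binProb (n - 2) (fun k => t + 1 < |(k : ℝ) - (n - 2 : ℕ) / 2|))
    (hqM : n * q ≤ 3 * M) :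
    1 - gprob {G : SimpleGraph (Fin n) |
        ((Set.ncard {i : Fin n | |(ndeg G i : ℝ) - n / 2| > t} : ℕ) : ℝ) ≤ 4 * M} ≤
      (n * q + 2 * n ^ 2 * q * (q - p)) / M ^ 2 := by
  have hq0 : 0 ≤ q := hqdef ▸ binProb_nonneg _ _
  set T : ℝ := (Fintype.card (SimpleGraph (Fin n)) : ℝ) with hTdef
  have hT : 0 < T := by
    rw [hTdef]
    exact_mod_cast Fintype.card_pos
  let E : SimpleGraph (Fin n) → Fin n → Prop := fun G i => |(ndeg G i : ℝ) - n / 2| > t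
  have hfar : ∀ (G : SimpleGraph (Fin n)) i j, E G i →
      t - 1 < |(#(otherNeighbors G i j) : ℝ) - (n - 2 : ℕ) / 2| := by
    intro G i j h
    have h1 := abs_ndeg_sub_sub_le hn G i j
    have h2 := abs_sub_abs_le_abs_sub ((ndeg G i : ℝ) - n / 2)
      (#(otherNeighbors G i j) - ((n - 2 : ℕ) : ℝ) / 2)
    have h3 : |(ndeg G i : ℝ) - n / 2| > t := h
    linarith
  have hnear : ∀ (G : SimpleGraph (Fin n)) i j,
      t + 1 < |(#(otherNeighbors G i j) : ℝ) - (n - 2 : ℕ) / 2| → E G i := by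
    intro G i j h
    have h1 := abs_ndeg_sub_sub_le hn G i j
    have h2 := abs_sub_abs_le_abs_sub (#(otherNeighbors G i j) - ((n - 2 : ℕ) : ℝ) / 2)
      ((ndeg G i : ℝ) - n / 2)
    rw [abs_sub_comm] at h1
    show |(ndeg G i : ℝ) - n / 2| > t
    linarith
  have : Nontrivial (Fin n) := Fin.nontrivial_iff_two_le.2 hn
  have hlow : ∀ i, T * p ≤ #{G | E G i} := by
    intro i
    obtain ⟨j, hji⟩ := exists_ne i
    have h := card_filter_card_otherNeighbors hji.symm
      (fun k => t + 1 < |(k : ℝ) - (n - 2 : ℕ) / 2|) (fun _ => True)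
    rw [binProb_true, mul_one, Fintype.card_fin, ← hpdef] at h
    rw [hTdef, ← h]
    norm_cast
    refine card_le_card fun G hG => ?_
    simp only [mem_filter, mem_univ, true_and, and_true] at hG ⊢
    exact hnear G i j hG
  have hupp : ∀ i, (#{G | E G i} : ℝ) ≤ T * q := by
    intro i
    obtain ⟨j, hji⟩ := exists_ne i
    have h := card_filter_card_otherNeighbors hji.symm
      (fun k => t - 1 < |(k : ℝ) - (n - 2 : ℕ) / 2|) (fun _ => True)
    rw [binProb_true, mul_one, Fintype.card_fin, ← hqdef] at h
    rw [hTdef, ← h]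
    norm_cast
    refine card_le_card fun G hG => ?_
    simp only [mem_filter, mem_univ, true_and, and_true] at hG ⊢
    exact hfar G i j hG
  have hpair : ∀ i j, i ≠ j → (#{G | E G i ∧ E G j} : ℝ) ≤ T * q ^ 2 := by
    intro i j hij
    have h := card_filter_card_otherNeighbors hij
      (fun k => t - 1 < |(k : ℝ) - (n - 2 : ℕ) / 2|)
      (fun k => t - 1 < |(k : ℝ) - (n - 2 : ℕ) / 2|)
    rw [Fintype.card_fin, ← hqdef] at h
    rw [hTdef, sq, ← mul_assoc, ← h]
    norm_cast
    refine card_le_card fun G hG => ?_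
    simp only [mem_filter, mem_univ, true_and] at hG ⊢
    exact ⟨hfar G i j hG.1, hfar G j i hG.2⟩
  have hcheb := card_filter_lt_mul_sq_le E hM.le hq0 hlow hupp hpair
  rw [Fintype.card_fin] at hcheb
  have hncard : ∀ G : SimpleGraph (Fin n),
      Set.ncard {i : Fin n | |(ndeg G i : ℝ) - n / 2| > t} = #{i | E G i} := by
    intro G
    rw [Set.ncard_eq_toFinset_card']
    congr 1
    ext i
    simp [E]
  have hgprob : gprob {G : SimpleGraph (Fin n) |
      ((Set.ncard {i : Fin n | |(ndeg G i : ℝ) - n / 2| > t} : ℕ) : ℝ) ≤ 4 * M} =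
      (#{G | (#{i | E G i} : ℝ) ≤ 4 * M} : ℝ) / T := by
    have hTpow : T = 2 ^ (Nat.card (Fin n)).choose 2 := by
      rw [hTdef, card_simpleGraph_eq_two_pow, Nat.card_eq_fintype_card]
      push_cast
      rfl
    rw [gprob, hTpow]
    congr 2
    simp_rw [hncard]
    rw [Nat.card_eq_fintype_card]
    exact Fintype.card_subtype _
  have hcompl : (#{G | (#{i | E G i} : ℝ) ≤ 4 * M} : ℝ) +
      #{G | ¬ (#{i | E G i} : ℝ) ≤ 4 * M} = T := by
    have := card_filter_add_card_filter_not (s := (univ : Finset (SimpleGraph (Fin n))))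
      (fun G => (#{i | E G i} : ℝ) ≤ 4 * M)
    rw [hTdef, ← card_univ]
    exact_mod_cast this
  have hsub : (#{G | ¬ (#{i | E G i} : ℝ) ≤ 4 * M} : ℝ) ≤
      #{G | n * q + M < #{i | E G i}} := by
    norm_cast
    refine card_le_card fun G hG => ?_
    simp only [mem_filter, mem_univ, true_and, not_le] at hG ⊢
    linarith
  rw [hgprob, le_div_iff₀ (by positivity)]
  have : 1 - (#{G | (#{i | E G i} : ℝ) ≤ 4 * M} : ℝ) / T =
      #{G | ¬ (#{i | E G i} : ℝ) ≤ 4 * M} / T := by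
    rw [← hcompl] at hT ⊢
    field_simp
    ring
  rw [this, div_mul_eq_mul_div, div_le_iff₀ hT, mul_comm _ T]
  exact (mul_le_mul_of_nonneg_right hsub (by positivity)).trans hcheb

lemma tendsto_log_natCast_atTop : Tendsto (fun n : ℕ => Real.log n) atTop atTop :=
  Real.tendsto_log_atTop.comp tendsto_natCast_atTop_atTop

lemma tendsto_zeta1 : Tendsto zeta1 atTop (nhds 0) := by
  have hlog : Tendsto (fun x : ℝ => Real.log x / x) atTop (nhds 0) :=
    Real.isLittleO_log_id_atTop.tendsto_div_nhds_zero
  have h : Tendsto (fun x : ℝ => Real.log (2 * Real.pi) / x + 3 / 2 * (Real.log x / x)) atTop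
      (nhds 0) := by
    simpa using (tendsto_const_nhds.div_atTop tendsto_id).add (hlog.const_mul (3 / 2))
  refine (h.comp tendsto_log_natCast_atTop).congr fun n => ?_
  simp only [Function.comp_apply, zeta1]
  ring

/-- The threshold `(1/2)·√(n·ln n·(1−ζ₁))`. -/
noncomputable def degreeThreshold (n : ℕ) : ℝ :=
  (1 / 2) * Real.sqrt ((n : ℝ) * Real.log n * (1 - zeta1 n))

lemma tendsto_sqrt_mul_sqrt_log :
    Tendsto (fun n : ℕ => √(n : ℝ) * √(Real.log n)) atTop atTop :=
  (Real.tendsto_sqrt_atTop.comp tendsto_natCast_atTop_atTop).atTop_mul_atTop₀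
    (Real.tendsto_sqrt_atTop.comp tendsto_log_natCast_atTop)

lemma tendsto_sqrt_log_div_sqrt :
    Tendsto (fun n : ℕ => √(Real.log n) / √(n : ℝ)) atTop (nhds 0) := by
  have h : Tendsto (fun n : ℕ => √(Real.log n / n)) atTop (nhds 0) := by
    have := (Real.continuous_sqrt.tendsto 0).comp
      (Real.isLittleO_log_id_atTop.tendsto_div_nhds_zero.comp
        (tendsto_natCast_atTop_atTop (R := ℝ)))
    rw [Real.sqrt_zero] at this
    exact this
  refine h.congr fun n => ?_
  rw [Real.sqrt_div' _ (Nat.cast_nonneg n)]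

lemma eventually_log_pos : ∀ᶠ n : ℕ in atTop, 0 < Real.log n :=
  tendsto_log_natCast_atTop.eventually_gt_atTop 0

lemma tendsto_degreeThreshold_div :
    Tendsto (fun n : ℕ => degreeThreshold n / (√(n : ℝ) * √(Real.log n))) atTop
      (nhds (1 / 2)) := by
  have h : Tendsto (fun n : ℕ => 1 / 2 * √(1 - zeta1 n)) atTop (nhds (1 / 2)) := by
    have := ((Real.continuous_sqrt.tendsto _).comp
      (tendsto_zeta1.const_sub 1)).const_mul (1 / 2)
    simpa using this
  refine h.congr' ?_
  filter_upwards [eventually_log_pos, eventually_gt_atTop 0] with n hL hn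
  have hn' : (0 : ℝ) < n := by exact_mod_cast hn
  rw [degreeThreshold, Real.sqrt_mul (by positivity), Real.sqrt_mul (by positivity)]
  have h1 : √(n : ℝ) ≠ 0 := by positivity
  have h2 : √(Real.log n) ≠ 0 := by positivity
  field_simp

lemma tendsto_degreeThreshold_atTop : Tendsto degreeThreshold atTop atTop := by
  refine (tendsto_sqrt_mul_sqrt_log.atTop_mul_pos (by norm_num : (0 : ℝ) < 1 / 2)
    tendsto_degreeThreshold_div).congr' ?_
  filter_upwards [tendsto_sqrt_mul_sqrt_log.eventually_gt_atTop 0] with n hn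
  rw [mul_div_cancel₀ _ hn.ne']

lemma tendsto_degreeThreshold_div_self :
    Tendsto (fun n : ℕ => degreeThreshold n / n) atTop (nhds 0) := by
  have h := tendsto_degreeThreshold_div.mul tendsto_sqrt_log_div_sqrt
  rw [mul_zero] at h
  refine h.congr' ?_
  filter_upwards [eventually_log_pos, eventually_gt_atTop 0] with n hL hn
  have hn' : (0 : ℝ) < n := by exact_mod_cast hn
  have h1 : √(n : ℝ) ≠ 0 := by positivity
  have h2 : √(Real.log n) ≠ 0 := by positivity
  field_simp
  rw [Real.sq_sqrt hn'.le]

lemma exp_neg_degreeThreshold_sq {n : ℕ} (hn : 0 < n) (hL : 0 < Real.log n)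
    (hz : 0 ≤ 1 - zeta1 n) :
    Real.exp (-(2 * degreeThreshold n ^ 2 / n)) =
      √(2 * Real.pi) * (√(Real.log n) * Real.log n ^ ((1 : ℝ) / 4)) / √(n : ℝ) := by
  have hn' : (0 : ℝ) < n := by exact_mod_cast hn
  rw [degreeThreshold, mul_pow, Real.sq_sqrt (by positivity), Real.sqrt_eq_rpow,
    Real.sqrt_eq_rpow, Real.sqrt_eq_rpow, Real.rpow_def_of_pos (by positivity),
    Real.rpow_def_of_pos hL, Real.rpow_def_of_pos hL, Real.rpow_def_of_pos hn', ← Real.exp_add,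
    ← Real.exp_add, ← Real.exp_sub, zeta1]
  congr 1
  field_simp
  ring

/-- The ratio between the bound on the expected number of deviating vertices and
`√n·(ln n)^{1/4}`. -/
noncomputable def deviationRatio (n : ℕ) : ℝ :=
  2 * √(2 * Real.pi) *
    Real.exp (1 / (2 * ((n : ℝ) - 1)) + 4 * (degreeThreshold n / n)) *
    √((n : ℝ) / (n - 1)) *
    (√(Real.log n) / √(n : ℝ) / 2 +
      1 / (4 * (degreeThreshold n / (√(n : ℝ) * √(Real.log n)) -
        1 / (√(n : ℝ) * √(Real.log n)))))

lemma tendsto_deviationRatio : Tendsto deviationRatio atTop (nhds √(2 * Real.pi)) := by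
  have hn1 : Tendsto (fun n : ℕ => (n : ℝ) - 1) atTop atTop :=
    tendsto_atTop_add_const_right _ _ tendsto_natCast_atTop_atTop
  have h1 : Tendsto (fun n : ℕ => 1 / (2 * ((n : ℝ) - 1)) + 4 * (degreeThreshold n / n)) atTop
      (nhds 0) := by
    have ha : Tendsto (fun n : ℕ => 1 / (2 * ((n : ℝ) - 1))) atTop (nhds 0) :=
      tendsto_const_nhds.div_atTop (hn1.const_mul_atTop two_pos)
    simpa using ha.add (tendsto_degreeThreshold_div_self.const_mul 4)
  have h2 : Tendsto (fun n : ℕ => (n : ℝ) / (n - 1)) atTop (nhds 1) := by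
    have ha : Tendsto (fun n : ℕ => 1 + 1 / ((n : ℝ) - 1)) atTop (nhds 1) := by
      simpa using (tendsto_const_nhds.div_atTop hn1 :
        Tendsto (fun n : ℕ => (1 : ℝ) / ((n : ℝ) - 1)) atTop (nhds 0)).const_add 1
    refine ha.congr' ?_
    filter_upwards [hn1.eventually_gt_atTop 0] with n hn
    field_simp
    ring
  have h3 : Tendsto (fun n : ℕ => √(Real.log n) / √(n : ℝ) / 2 +
      1 / (4 * (degreeThreshold n / (√(n : ℝ) * √(Real.log n)) -
        1 / (√(n : ℝ) * √(Real.log n))))) atTop (nhds (1 / 2)) := by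
    have ha : Tendsto (fun n : ℕ => 1 / (√(n : ℝ) * √(Real.log n))) atTop (nhds 0) :=
      tendsto_const_nhds.div_atTop tendsto_sqrt_mul_sqrt_log
    have hb := ((tendsto_const_nhds (x := (1 : ℝ))).div
      ((tendsto_degreeThreshold_div.sub ha).const_mul 4) (by norm_num))
    have hc := (tendsto_sqrt_log_div_sqrt.div_const 2).add hb
    norm_num at hc ⊢
    exact hc
  have h4 := ((((Real.continuous_exp.tendsto 0).comp h1).const_mul (2 * √(2 * Real.pi))).mul
    ((Real.continuous_sqrt.tendsto 1).comp h2)).mul h3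
  rw [Real.exp_zero, Real.sqrt_one, show 2 * √(2 * Real.pi) * 1 * 1 * (1 / 2) =
    √(2 * Real.pi) by ring] at h4
  exact h4

lemma mul_binProb_degreeThreshold_le {n : ℕ} (hn : 2 ≤ n) (hL : 0 < Real.log n)
    (hz : 0 ≤ 1 - zeta1 n) (ht : 1 < degreeThreshold n) :
    n * binProb (n - 2) (fun k => degreeThreshold n - 1 < |(k : ℝ) - (n - 2 : ℕ) / 2|) ≤
      deviationRatio n * (√(n : ℝ) * Real.log n ^ ((1 : ℝ) / 4)) := by
  have hn2 : (2 : ℝ) ≤ n := by exact_mod_cast hn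
  have hn0 : (0 : ℝ) < n := by linarith
  have hcast : (((n - 2 : ℕ) : ℝ) + 1) = n - 1 := by
    rw [Nat.cast_sub hn]
    push_cast
    ring
  set t := degreeThreshold n with htdef
  have htail := binProb_tail_le (n - 2) (u := t - 1) (by linarith)
  rw [hcast] at htail
  have hexp : Real.exp (1 / (2 * ((n : ℝ) - 1)) - 2 * (t - 1) ^ 2 / (n - 1)) ≤
      Real.exp (1 / (2 * ((n : ℝ) - 1)) + 4 * (t / n)) *
        (√(2 * Real.pi) * (√(Real.log n) * Real.log n ^ ((1 : ℝ) / 4)) / √(n : ℝ)) := by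
    rw [← exp_neg_degreeThreshold_sq (by omega) hL hz, ← Real.exp_add, ← htdef]
    refine Real.exp_le_exp.2 ?_
    have h1 : 2 * (t - 1) ^ 2 / (n : ℝ) ≤ 2 * (t - 1) ^ 2 / (n - 1) :=
      div_le_div_of_nonneg_left (by positivity) (by linarith) (by linarith)
    have h2 : 2 * t ^ 2 / n - 4 * (t / n) ≤ 2 * (t - 1) ^ 2 / (n : ℝ) := by
      rw [show 2 * t ^ 2 / n - 4 * (t / n) = (2 * t ^ 2 - 4 * t) / n by ring]
      gcongr
      nlinarith
    linarith
  have hfrac : (1 : ℝ) / 2 + ((n - 2 : ℕ) : ℝ) / (4 * (t - 1)) ≤ 1 / 2 + n / (4 * (t - 1)) := by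
    have : 0 < t - 1 := by linarith
    gcongr
    omega
  have hn1 : (0 : ℝ) < n - 1 := by linarith
  have ht1 : t - 1 ≠ 0 := by linarith
  have hs : √(n : ℝ) ≠ 0 := by positivity
  have hs1 : √((n : ℝ) - 1) ≠ 0 := by positivity
  have hl : √(Real.log n) ≠ 0 := by positivity
  calc _ ≤ n * (2 * (1 / √((n : ℝ) - 1) *
        (Real.exp (1 / (2 * ((n : ℝ) - 1)) + 4 * (t / n)) *
          (√(2 * Real.pi) * (√(Real.log n) * Real.log n ^ ((1 : ℝ) / 4)) / √(n : ℝ))) *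
        (1 / 2 + n / (4 * (t - 1))))) := by
        refine mul_le_mul_of_nonneg_left (htail.trans ?_) hn0.le
        gcongr
    _ = _ := by
      rw [deviationRatio, ← htdef, ← sub_div, Real.sqrt_div hn0.le]
      generalize Real.exp (1 / (2 * ((n : ℝ) - 1)) + 4 * (t / n)) = e
      generalize Real.log n ^ ((1 : ℝ) / 4) = l
      generalize √((n : ℝ) - 1) = s1 at *
      have hsq : (n : ℝ) = √(n : ℝ) ^ 2 := (Real.sq_sqrt hn0.le).symm
      generalize √(n : ℝ) = s at *
      rw [hsq]
      field_simp

lemma sqrt_two_pi_lt_three : √(2 * Real.pi) < 3 := by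
  rw [Real.sqrt_lt' (by norm_num)]
  linarith [Real.pi_lt_d2]

/-- Whp at most `4·√n·(ln n)^{1/4}` vertices have degree deviating from `n/2` by more than
`(1/2)·√(n·ln n·(1−ζ₁))`. -/
theorem few_vertices_with_deviating_degree :
    Tendsto (fun n : ℕ => gprob {G : SimpleGraph (Fin n) |
      ((Set.ncard {i : Fin n |
          |(ndeg G i : ℝ) - (n : ℝ) / 2| >
            (1 / 2) * Real.sqrt ((n : ℝ) * Real.log n * (1 - zeta1 n))} : ℕ) : ℝ)
        ≤ 4 * Real.sqrt n * Real.log n ^ ((1 : ℝ) / 4)}) atTop (nhds 1) := by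
  set M : ℕ → ℝ := fun n => √(n : ℝ) * Real.log n ^ ((1 : ℝ) / 4) with hM
  have hsqrt : Tendsto (fun n : ℕ => √(n : ℝ)) atTop atTop :=
    Real.tendsto_sqrt_atTop.comp tendsto_natCast_atTop_atTop
  have hroot : Tendsto (fun n : ℕ => Real.log n ^ ((1 : ℝ) / 4)) atTop atTop :=
    (tendsto_rpow_atTop (by norm_num)).comp tendsto_log_natCast_atTop
  have hMtop : Tendsto M atTop atTop := hsqrt.atTop_mul_atTop₀ hroot
  have herr : Tendsto (fun n : ℕ => 1 - (3 / M n + 48 / Real.log n ^ ((1 : ℝ) / 4))) atTop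
      (nhds 1) := by
    simpa using ((tendsto_const_nhds.div_atTop hMtop).add
      (tendsto_const_nhds.div_atTop hroot)).const_sub (1 : ℝ)
  refine tendsto_of_tendsto_of_tendsto_of_le_of_le' herr tendsto_const_nhds ?_ ?_
  · filter_upwards [eventually_ge_atTop 2, eventually_log_pos,
      tendsto_zeta1.eventually_le_const one_pos, tendsto_degreeThreshold_atTop.eventually_gt_atTop 1,
      tendsto_deviationRatio.eventually_le_const sqrt_two_pi_lt_three,
      hMtop.eventually_gt_atTop 0] with n hn hL hz ht hF hMpos
    have hn2 : (2 : ℝ) ≤ n := by exact_mod_cast hn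
    obtain ⟨q, hq⟩ : ∃ q, q = binProb (n - 2)
      (fun k => degreeThreshold n - 1 < |(k : ℝ) - (n - 2 : ℕ) / 2|) := ⟨_, rfl⟩
    obtain ⟨p, hp⟩ : ∃ p, p = binProb (n - 2)
      (fun k => degreeThreshold n + 1 < |(k : ℝ) - (n - 2 : ℕ) / 2|) := ⟨_, rfl⟩
    have hq0 : 0 ≤ q := hq ▸ binProb_nonneg _ _
    have hqM : n * q ≤ 3 * M n := by
      rw [hq]
      refine (mul_binProb_degreeThreshold_le hn hL (by linarith) ht).trans ?_
      gcongr
    have hqp : q - p ≤ 8 / √(n : ℝ) := by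
      have h := binProb_tail_sub_le (n - 2) (u := degreeThreshold n - 1) (by linarith)
      rw [show degreeThreshold n - 1 + 2 = degreeThreshold n + 1 by ring, ← hq, ← hp,
        Nat.cast_sub hn] at h
      have h4 : 4 / √((n : ℝ) - (2 : ℕ) + 1) ≤ 8 / √(n : ℝ) := by
        have hle : √(n : ℝ) ≤ 2 * √((n : ℝ) - (2 : ℕ) + 1) := by
          rw [Real.sqrt_le_left (by positivity), mul_pow, Real.sq_sqrt] <;> push_cast <;> linarith
        have hpos : 0 < √((n : ℝ) - (2 : ℕ) + 1) := Real.sqrt_pos.2 (by push_cast; linarith)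
        rw [div_le_div_iff₀ hpos (by positivity)]
        linarith
      linarith
    have hmain := one_sub_gprob_le hn hMpos hq hp hqM
    have hbound : (n * q + 2 * n ^ 2 * q * (q - p)) / M n ^ 2 ≤
        3 / M n + 48 / Real.log n ^ ((1 : ℝ) / 4) := by
      have hs : √(n : ℝ) ≠ 0 := by positivity
      have hl : Real.log n ^ ((1 : ℝ) / 4) ≠ 0 := by positivity
      calc (n * q + 2 * n ^ 2 * q * (q - p)) / M n ^ 2
          = (n * q + 2 * n * (n * q) * (q - p)) / M n ^ 2 := by ring
        _ ≤ (n * q + 2 * n * (n * q) * (8 / √(n : ℝ))) / M n ^ 2 := by gcongr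
        _ ≤ (3 * M n + 2 * n * (3 * M n) * (8 / √(n : ℝ))) / M n ^ 2 := by gcongr
        _ = 3 / M n + 48 * (n / √(n : ℝ)) / M n := by
          field_simp
          ring
        _ = _ := by
          rw [Real.div_sqrt, hM]
          field_simp
    simp only [hM, degreeThreshold, ← mul_assoc] at hmain hbound ⊢
    linarith
  · filter_upwards with n
    have hT : ((Nat.card (SimpleGraph (Fin n)) : ℕ) : ℝ) = 2 ^ (Nat.card (Fin n)).choose 2 := by
      rw [Nat.card_eq_fintype_card, card_simpleGraph_eq_two_pow, Nat.card_eq_fintype_card]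
      push_cast
      rfl
    rw [gprob, ← hT]
    refine div_le_one_of_le₀ ?_ (Nat.cast_nonneg _)
    exact_mod_cast Nat.card_le_card_of_injective _ Subtype.val_injective
end
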